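/- arXiv:math/0609708 — 2 statements merged into one kernel-verified Lean document; each statement's English description precedes it below -/
import Mathlib

section
/- Let q > 1 be a real number, let α₁ = ⌈q⌉ − 1, and let (α_i) = (α_i(q)) be the quasi-greedy expansion of 1 in base q. A sequence (b_i)_{i≥1} with terms in {0, …, α₁} is a greedy sequence in base q (i.e., it is the greedy expansion in base q of the number x = ∑_{i=1}^∞ b_i q^{−i}) if and only if for every n ≥ 1 with b_n < α₁, the shifted sequence (b_{n+i})_{i≥1} is lexicographically smaller than (α_i)_{i≥1}. -/
open Classical

noncomputable section

/-- The largest digit in base `q`: `α₁ = ⌈q⌉ - 1`. -/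
def alphaOne (q : ℝ) : ℕ := (⌈q⌉ - 1).toNat

/-- `c` (0-indexed: `c i` is the digit `c_{i+1}` of the paper) is an expansion of `x`
in base `q`: all digits lie in `{0, …, α₁}` and `x = ∑_{i≥1} c_i q^{-i}`. -/
def IsExpansionOf (q x : ℝ) (c : ℕ → ℕ) : Prop :=
  (∀ i, c i ≤ alphaOne q) ∧ x = ∑' i, (c i : ℝ) / q ^ (i + 1)

/-- A sequence is called infinite if it has infinitely many nonzero terms. -/
def InfiniteSeq (c : ℕ → ℕ) : Prop := {i | c i ≠ 0}.Infinite

/-- Strict lexicographic order on sequences. -/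
def LexLt (a b : ℕ → ℕ) : Prop := ∃ n, (∀ i, i < n → a i = b i) ∧ a n < b n

/-- Lexicographic order `≤` on sequences. -/
def LexLe (a b : ℕ → ℕ) : Prop := LexLt a b ∨ a = b

/-- `b` is the greedy (lexicographically largest) expansion of `x` in base `q`. -/
def IsGreedyOf (q x : ℝ) (b : ℕ → ℕ) : Prop :=
  IsExpansionOf q x b ∧ ∀ c, IsExpansionOf q x c → LexLe c b

/-- `a` is the quasi-greedy (lexicographically largest infinite) expansion of `x`
in base `q`. -/
def IsQuasiGreedyOf (q x : ℝ) (a : ℕ → ℕ) : Prop :=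
  IsExpansionOf q x a ∧ InfiniteSeq a ∧
    ∀ c, IsExpansionOf q x c → InfiniteSeq c → LexLe c a

/-- The quasi-greedy expansion of `x` in base `q`; by convention it is the zero
sequence whenever no infinite expansion exists (in particular for `x = 0`). -/
def quasiGreedy (q x : ℝ) : ℕ → ℕ :=
  if h : ∃ a, IsQuasiGreedyOf q x a then h.choose else fun _ => 0

/-- The greedy expansion of `x` in base `q` (zero sequence if `x` has no expansion). -/
def greedy (q x : ℝ) : ℕ → ℕ :=
  if h : ∃ b, IsGreedyOf q x b then h.choose else fun _ => 0

/-- The interval `J_q = [0, α₁/(q-1)]`. -/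
def Jq (q : ℝ) : Set ℝ := Set.Icc 0 ((alphaOne q : ℝ) / (q - 1))

/-- `U_q`: the set of real numbers having exactly one expansion in base `q`. -/
def Uq (q : ℝ) : Set ℝ := {x | ∃! c, IsExpansionOf q x c}

/-- `U_q'`: the set of univoque sequences in base `q`. -/
def UqSeq (q : ℝ) : Set (ℕ → ℕ) := {c | ∃ x ∈ Uq q, IsExpansionOf q x c}

/-- `U`: the set of univoque numbers. -/
def USet : Set ℝ := {q | 1 < q ∧ ∃! c, IsExpansionOf q 1 c}

/-- `V_q`: the set of `x ∈ J_q` such that for every `n ≥ 1` with `a_n(x) > 0` the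
conjugated shifted quasi-greedy expansion is lexicographically at most `(α_i)`. -/
def Vq (q : ℝ) : Set ℝ :=
  {x | x ∈ Jq q ∧ ∀ n, 0 < quasiGreedy q x n →
    LexLe (fun i => alphaOne q - quasiGreedy q x (n + 1 + i)) (quasiGreedy q 1)}

/-- `V`: the set of `q > 1` whose quasi-greedy expansion `(α_i)` of `1` satisfies
`(α₁ - α_{k+i})_{i≥1} ≤ (α_i)_{i≥1}` lexicographically for all `k ≥ 1`. -/
def VSet : Set ℝ :=
  {q | 1 < q ∧ ∀ k, LexLe (fun i => alphaOne q - quasiGreedy q 1 (k + 1 + i)) (quasiGreedy q 1)}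

/-- The value `∑_{i ≥ 1} c_i q^{-i}` of a digit sequence. -/
def baseValue (q : ℝ) (c : ℕ → ℕ) : ℝ := ∑' i, (c i : ℝ) / q ^ (i + 1)

section Order

theorem lexLt_trichotomy (a b : ℕ → ℕ) : LexLt a b ∨ a = b ∨ LexLt b a := by
  by_cases h : a = b
  · exact Or.inr (Or.inl h)
  have hex : ∃ n, a n ≠ b n := Function.ne_iff.mp h
  have hmin : ∀ i, i < Nat.find hex → a i = b i := fun i hi => not_not.mp (Nat.find_min hex hi)
  rcases lt_or_gt_of_ne (Nat.find_spec hex) with hlt | hgt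
  · exact Or.inl ⟨_, hmin, hlt⟩
  · exact Or.inr (Or.inr ⟨_, fun i hi => (hmin i hi).symm, hgt⟩)

theorem LexLt.not_lexLe {a b : ℕ → ℕ} (h : LexLt a b) : ¬ LexLe b a := by
  obtain ⟨n, hn, hlt⟩ := h
  rintro (⟨m, hm, hlt'⟩ | rfl)
  · rcases lt_trichotomy n m with h | rfl | h
    · exact absurd (hm n h) hlt.ne'
    · exact lt_asymm hlt hlt'
    · exact absurd (hn m h) hlt'.ne'
  · exact lt_irrefl _ hlt

theorem lexLe_of_not_lexLt {a b : ℕ → ℕ} (h : ¬ LexLt b a) : LexLe a b := by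
  rcases lexLt_trichotomy a b with h' | h' | h'
  · exact Or.inl h'
  · exact Or.inr h'
  · exact absurd h' h

theorem LexLe.antisymm {a b : ℕ → ℕ} (h : LexLe a b) (h' : LexLe b a) : a = b := by
  rcases h with h | h
  · exact absurd h' h.not_lexLe
  · exact h

end Order

section Digit

variable {q : ℝ}

theorem alphaOne_cast (hq : 1 < q) : (alphaOne q : ℤ) = ⌈q⌉ - 1 := by
  have h : (1 : ℤ) < ⌈q⌉ := Int.lt_ceil.mpr (by exact_mod_cast hq)
  unfold alphaOne
  omega

theorem le_alphaOne_add_one (hq : 1 < q) : q ≤ alphaOne q + 1 := by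
  have h := Int.le_ceil q
  have h' : ((alphaOne q : ℤ) : ℝ) = ⌈q⌉ - 1 := by rw [alphaOne_cast hq]; push_cast; ring
  push_cast at h'
  linarith

theorem one_le_alphaOne_div (hq : 1 < q) : 1 ≤ (alphaOne q : ℝ) / (q - 1) := by
  rw [le_div_iff₀ (by linarith)]
  linarith [le_alphaOne_add_one hq]

end Digit

section Value

variable {q : ℝ} {M : ℕ}

theorem hasSum_const_div_pow (hq : 1 < q) (m : ℝ) :
    HasSum (fun i : ℕ => m / q ^ (i + 1)) (m / (q - 1)) := by
  have hq0 : q ≠ 0 := by positivity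
  have h := (hasSum_geometric_of_lt_one (r := q⁻¹) (by positivity)
    (inv_lt_one_of_one_lt₀ hq)).mul_left (m / q)
  have hval : m / q * (1 - q⁻¹)⁻¹ = m / (q - 1) := by
    rw [div_mul_eq_mul_div, ← div_eq_mul_inv, div_div, sub_mul, one_mul, inv_mul_cancel₀ hq0]
  rw [hval] at h
  have hterm : ∀ i : ℕ, m / q * q⁻¹ ^ i = m / q ^ (i + 1) := fun i => by
    rw [inv_pow, pow_succ]
    field_simp
  simpa only [hterm] using h

theorem summable_baseValue (hq : 1 < q) {c : ℕ → ℕ} (hc : ∀ i, c i ≤ M) :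
    Summable fun i => (c i : ℝ) / q ^ (i + 1) := by
  refine Summable.of_nonneg_of_le (fun i => by positivity) (fun i => ?_)
    (hasSum_const_div_pow hq M).summable
  have : (c i : ℝ) ≤ M := by exact_mod_cast hc i
  gcongr

theorem baseValue_nonneg (hq : 1 < q) (c : ℕ → ℕ) : 0 ≤ baseValue q c :=
  tsum_nonneg fun i => by positivity

theorem baseValue_le (hq : 1 < q) {c : ℕ → ℕ} (hc : ∀ i, c i ≤ M) :
    baseValue q c ≤ M / (q - 1) := by
  rw [← (hasSum_const_div_pow hq M).tsum_eq]
  refine (summable_baseValue hq hc).tsum_le_tsum (fun i => ?_)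
    (hasSum_const_div_pow hq M).summable
  have : (c i : ℝ) ≤ M := by exact_mod_cast hc i
  gcongr

theorem baseValue_pos (hq : 1 < q) {c : ℕ → ℕ} (hc : ∀ i, c i ≤ M) {k : ℕ} (hk : c k ≠ 0) :
    0 < baseValue q c := by
  have hpos : (0 : ℝ) < c k := by exact_mod_cast Nat.pos_of_ne_zero hk
  exact (summable_baseValue hq hc).tsum_pos (fun i => by positivity) k (by positivity)

theorem baseValue_eq_sum_add (hq : 1 < q) {c : ℕ → ℕ} (hc : ∀ i, c i ≤ M) (n : ℕ) :
    baseValue q c = ∑ i ∈ Finset.range n, (c i : ℝ) / q ^ (i + 1)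
      + baseValue q (fun i => c (n + i)) / q ^ n := by
  have hq0 : q ≠ 0 := by positivity
  unfold baseValue
  rw [← (summable_baseValue hq hc).sum_add_tsum_nat_add n, ← tsum_div_const]
  congr 2
  funext i
  rw [div_div, add_comm i n, ← pow_add]
  congr 2
  ring

/-- Comparison of two sequences that agree on their first `n` digits. -/
theorem baseValue_sub_baseValue (hq : 1 < q) {c d : ℕ → ℕ} (hc : ∀ i, c i ≤ M)
    (hd : ∀ i, d i ≤ M) {n : ℕ} (h : ∀ i, i < n → c i = d i) :
    baseValue q c - baseValue q d =
      ((c n - d n) + (baseValue q (fun i => c (n + 1 + i))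
        - baseValue q (fun i => d (n + 1 + i)))) / q ^ (n + 1) := by
  have hsum : ∑ i ∈ Finset.range n, (c i : ℝ) / q ^ (i + 1)
      = ∑ i ∈ Finset.range n, (d i : ℝ) / q ^ (i + 1) :=
    Finset.sum_congr rfl fun i hi => by rw [h i (Finset.mem_range.mp hi)]
  rw [baseValue_eq_sum_add hq hc (n + 1), baseValue_eq_sum_add hq hd (n + 1),
    Finset.sum_range_succ, Finset.sum_range_succ, hsum]
  ring

/-- Bounded remainders `x (n + 1) = q * x n - d n` exhibit `d` as an expansion of `x 0`. -/
theorem baseValue_eq_of_remainder (hq : 1 < q) {d : ℕ → ℕ} (hd : ∀ i, d i ≤ M) {x : ℕ → ℝ}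
    {C : ℝ} (hx : ∀ n, x (n + 1) = q * x n - d n) (h0 : ∀ n, 0 ≤ x n) (hC : ∀ n, x n ≤ C) :
    baseValue q d = x 0 := by
  have hq0 : q ≠ 0 := by positivity
  have hpartial : ∀ n, ∑ i ∈ Finset.range n, (d i : ℝ) / q ^ (i + 1) = x 0 - x n / q ^ n := by
    intro n
    induction n with
    | zero => simp
    | succ n ih =>
      rw [Finset.sum_range_succ, ih, hx n]
      field_simp
      ring
  have hlim : Filter.Tendsto (fun n => x n / q ^ n) Filter.atTop (nhds 0) := by
    have hgeom : Filter.Tendsto (fun n => C / q ^ n) Filter.atTop (nhds 0) :=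
      Filter.Tendsto.div_atTop tendsto_const_nhds (tendsto_pow_atTop_atTop_of_one_lt hq)
    refine squeeze_zero (fun n => ?_) (fun n => ?_) hgeom
    · have := h0 n
      positivity
    · have := hC n
      gcongr
  have hsum := (summable_baseValue hq hd).hasSum.tendsto_sum_nat
  simp only [hpartial] at hsum
  have := tendsto_nhds_unique hsum (tendsto_const_nhds.sub hlim)
  simpa [baseValue] using this

theorem isExpansionOf_iff {x : ℝ} {c : ℕ → ℕ} :
    IsExpansionOf q x c ↔ (∀ i, c i ≤ alphaOne q) ∧ x = baseValue q c := Iff.rfl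

end Value

section Existence

variable {q : ℝ}

/-- Every number of `J_q` has an expansion. -/
theorem exists_isExpansionOf (hq : 1 < q) {y : ℝ} (hy : y ∈ Jq q) :
    ∃ c, IsExpansionOf q y c := by
  have hq1 : 0 < q - 1 := by linarith
  let digit : ℝ → ℕ := fun r => min (alphaOne q) ⌊q * r⌋₊
  let x : ℕ → ℝ := fun n => n.rec y fun _ r => q * r - digit r
  have hmem : ∀ n, x n ∈ Jq q := by
    intro n
    induction n with
    | zero => exact hy
    | succ n ih =>
      obtain ⟨h0, h1⟩ := ih
      change q * x n - digit (x n) ∈ Jq q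
      have hnn : 0 ≤ q * x n := by positivity
      have hle : (digit (x n) : ℝ) ≤ ⌊q * x n⌋₊ := by exact_mod_cast min_le_right _ _
      refine ⟨by linarith [Nat.floor_le hnn], ?_⟩
      rcases le_total (alphaOne q) ⌊q * x n⌋₊ with h | h
      · have hd : digit (x n) = alphaOne q := min_eq_left h
        rw [hd]
        rw [le_div_iff₀ hq1] at h1 ⊢
        nlinarith
      · have hd : digit (x n) = ⌊q * x n⌋₊ := min_eq_right h
        rw [hd]
        linarith [Nat.lt_floor_add_one (q * x n), one_le_alphaOne_div hq]
  have hdigit : ∀ i, digit (x i) ≤ alphaOne q := fun i => min_le_left _ _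
  exact ⟨fun n => digit (x n), hdigit, (baseValue_eq_of_remainder hq hdigit (fun _ => rfl)
    (fun n => (hmem n).1) (fun n => (hmem n).2)).symm⟩

/-- The number `1` has a quasi-greedy expansion, all of whose tails have value in `(0, 1]`. -/
theorem exists_isQuasiGreedyOf_one (hq : 1 < q) :
    ∃ a, IsQuasiGreedyOf q 1 a ∧ ∀ n, baseValue q (fun i => a (n + i)) ∈ Set.Ioc (0 : ℝ) 1 := by
  have hq0 : 0 < q := by linarith
  let digit : ℝ → ℕ := fun r => ⌈q * r⌉₊ - 1
  let x : ℕ → ℝ := fun n => n.rec 1 fun _ r => q * r - digit r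
  have hcast : ∀ r : ℝ, 0 < r → (digit r : ℝ) = ⌈q * r⌉₊ - 1 := fun r hr => by
    have : 1 ≤ ⌈q * r⌉₊ := Nat.one_le_ceil_iff.mpr (by positivity)
    simp [digit, Nat.cast_sub this]
  have hmem : ∀ n, x n ∈ Set.Ioc (0 : ℝ) 1 := by
    intro n
    induction n with
    | zero => exact ⟨one_pos, le_rfl⟩
    | succ n ih =>
      have hnn : 0 ≤ q * x n := mul_nonneg hq0.le ih.1.le
      change q * x n - digit (x n) ∈ Set.Ioc (0 : ℝ) 1
      rw [hcast _ ih.1]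
      exact ⟨by linarith [Nat.ceil_lt_add_one hnn], by linarith [Nat.le_ceil (q * x n)]⟩
  have hdigit : ∀ i, digit (x i) ≤ alphaOne q := by
    intro i
    have h : q * x i ≤ ((alphaOne q + 1 : ℕ) : ℝ) := by
      push_cast
      nlinarith [le_alphaOne_add_one hq, (hmem i).2]
    exact Nat.sub_le_iff_le_add.mpr (Nat.ceil_le.mpr h)
  have htail : ∀ n, baseValue q (fun i => digit (x (n + i))) = x n := fun n =>
    baseValue_eq_of_remainder hq (x := fun i => x (n + i)) (fun i => hdigit (n + i))
      (fun _ => rfl) (fun i => (hmem (n + i)).1.le) (fun i => (hmem (n + i)).2)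
  have hexp : IsExpansionOf q 1 fun n => digit (x n) := by
    refine isExpansionOf_iff.mpr ⟨hdigit, ?_⟩
    have h := htail 0
    simp only [zero_add] at h
    exact h.symm
  refine ⟨fun n => digit (x n), ⟨hexp, ?_, ?_⟩, fun n => by rw [htail n]; exact hmem n⟩
  · rw [InfiniteSeq, Set.infinite_iff_exists_gt]
    intro n
    by_contra! hzero
    have hz : ∀ i, digit (x (n + 1 + i)) = 0 := fun i =>
      of_not_not fun h => absurd (hzero _ h) (by omega)
    have h := htail (n + 1)
    simp only [hz, baseValue, Nat.cast_zero, zero_div, tsum_zero] at h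
    exact absurd h (hmem (n + 1)).1.ne
  · intro c hc hinf
    refine lexLe_of_not_lexLt ?_
    rintro ⟨n, hn, hlt⟩
    have hsub := baseValue_sub_baseValue hq hdigit hc.1 hn
    have hvals : baseValue q (fun n => digit (x n)) - baseValue q c = 0 :=
      sub_eq_zero.mpr (hexp.2.symm.trans hc.2)
    rw [hvals, htail, eq_comm, div_eq_zero_iff, or_iff_left (by positivity)] at hsub
    obtain ⟨k, hk, hnk⟩ := hinf.exists_gt n
    have hpos : 0 < baseValue q (fun i => c (n + 1 + i)) := by
      refine baseValue_pos hq (fun i => hc.1 _) (k := k - (n + 1)) ?_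
      rwa [Nat.add_sub_cancel' (by omega)]
    have hle : (digit (x n) : ℝ) + 1 ≤ c n := by exact_mod_cast hlt
    linarith [(hmem (n + 1)).2]

theorem quasiGreedy_one_spec (hq : 1 < q) :
    IsQuasiGreedyOf q 1 (quasiGreedy q 1) ∧
      ∀ n, baseValue q (fun i => quasiGreedy q 1 (n + i)) ∈ Set.Ioc (0 : ℝ) 1 := by
  obtain ⟨a, ha, htail⟩ := exists_isQuasiGreedyOf_one hq
  have hex : ∃ a, IsQuasiGreedyOf q 1 a := ⟨a, ha⟩
  have hspec : IsQuasiGreedyOf q 1 (quasiGreedy q 1) := by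
    rw [quasiGreedy, dif_pos hex]
    exact hex.choose_spec
  have heq : quasiGreedy q 1 = a :=
    (ha.2.2 _ hspec.1 hspec.2.1).antisymm (hspec.2.2 _ ha.1 ha.2.1)
  rw [heq]
  exact ⟨ha, htail⟩

end Existence

section Parry

variable {q : ℝ} {b : ℕ → ℕ}

/-- A sequence is greedy iff the tails following a digit `b n < α₁` have value less than `1`. -/
theorem isGreedyOf_iff_baseValue_lt_one (hq : 1 < q) (hb : ∀ i, b i ≤ alphaOne q) :
    IsGreedyOf q (baseValue q b) b ↔
      ∀ n, b n < alphaOne q → baseValue q (fun i => b (n + 1 + i)) < 1 := by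
  have hq0 : 0 < q := by linarith
  constructor
  · rintro ⟨-, hmax⟩ n hn
    by_contra! hge
    obtain ⟨d, hd, hval⟩ := exists_isExpansionOf (y := baseValue q (fun i => b (n + 1 + i)) - 1) hq
      ⟨by linarith, by linarith [baseValue_le hq (c := fun i => b (n + 1 + i)) fun i => hb _]⟩
    let c : ℕ → ℕ := fun i => if i < n then b i else if i = n then b n + 1 else d (i - (n + 1))
    have hagree : ∀ i, i < n → b i = c i := fun i hi => by simp [c, hi]
    have hcn : c n = b n + 1 := by simp [c]
    have hctail : (fun i => c (n + 1 + i)) = d := by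
      funext i
      simp [c, show ¬ n + 1 + i < n by omega, show n + 1 + i ≠ n by omega]
    have hc : ∀ i, c i ≤ alphaOne q := by
      intro i
      dsimp only [c]
      split_ifs
      · exact hb i
      · exact hn
      · exact hd _
    have hsub := baseValue_sub_baseValue hq hb hc hagree
    have hval' : baseValue q (fun i => b (n + 1 + i)) - 1 = baseValue q d := hval
    rw [hctail, hcn, ← hval'] at hsub
    push_cast at hsub
    have hvals : baseValue q b = baseValue q c := by
      rw [← sub_eq_zero, hsub]
      ring
    exact LexLt.not_lexLe ⟨n, hagree, by omega⟩ (hmax c ⟨hc, hvals⟩)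
  · refine fun h => ⟨⟨hb, rfl⟩, fun c hc => lexLe_of_not_lexLt ?_⟩
    rintro ⟨n, hagree, hlt⟩
    have hsub := baseValue_sub_baseValue hq hb hc.1 hagree
    have hvals : baseValue q b - baseValue q c = 0 := sub_eq_zero.mpr hc.2
    rw [hvals, eq_comm, div_eq_zero_iff, or_iff_left (by positivity)] at hsub
    have hle : (b n : ℝ) + 1 ≤ c n := by exact_mod_cast hlt
    linarith [h n (hlt.trans_le (hc.1 n)), baseValue_nonneg hq (fun i => c (n + 1 + i))]

theorem lexLt_quasiGreedy_of_baseValue_lt_one (hq : 1 < q) (hb : ∀ i, b i ≤ alphaOne q)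
    (h : baseValue q b < 1) : LexLt b (quasiGreedy q 1) := by
  have hq0 : 0 < q := by linarith
  obtain ⟨⟨⟨hdig, hval⟩, -⟩, htail⟩ := quasiGreedy_one_spec hq
  change 1 = baseValue q (quasiGreedy q 1) at hval
  rcases lexLt_trichotomy b (quasiGreedy q 1) with hlt | rfl | ⟨k, hagree, hk⟩
  · exact hlt
  · exact absurd hval.symm h.ne
  · have hsub := baseValue_sub_baseValue hq hdig hb hagree
    have hle : (quasiGreedy q 1 k : ℝ) + 1 ≤ b k := by exact_mod_cast hk
    have hnonpos : baseValue q (quasiGreedy q 1) - baseValue q b ≤ 0 := by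
      rw [hsub]
      refine div_nonpos_of_nonpos_of_nonneg ?_ (by positivity)
      linarith [(htail (k + 1)).2, baseValue_nonneg hq (fun i => b (k + 1 + i))]
    linarith

/-- A sequence first falling below `(α_i)` at position `k` has value exceeding `1` by less than
`q^{-(k+1)}` times the excess of its tail after position `k`. -/
theorem baseValue_sub_one_lt (hq : 1 < q) (hb : ∀ i, b i ≤ alphaOne q) {k : ℕ}
    (hagree : ∀ i, i < k → b i = quasiGreedy q 1 i) (hk : b k < quasiGreedy q 1 k) :
    baseValue q b - 1 < (baseValue q (fun i => b (k + 1 + i)) - 1) / q ^ (k + 1) := by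
  have hq0 : 0 < q := by linarith
  obtain ⟨⟨⟨hdig, hval⟩, -⟩, htail⟩ := quasiGreedy_one_spec hq
  have hsub := baseValue_sub_baseValue hq hb hdig hagree
  rw [show baseValue q (quasiGreedy q 1) = 1 from hval.symm] at hsub
  rw [hsub]
  have hle : (b k : ℝ) + 1 ≤ quasiGreedy q 1 k := by exact_mod_cast hk
  gcongr
  linarith [(htail (k + 1)).1]

theorem baseValue_lt_one_of_lexLt (hq : 1 < q) (hb : ∀ i, b i ≤ alphaOne q)
    (h : ∀ n, b n < alphaOne q → LexLt (fun i => b (n + 1 + i)) (quasiGreedy q 1))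
    {n : ℕ} (hn : b n < alphaOne q) : baseValue q (fun i => b (n + 1 + i)) < 1 := by
  have hq0 : 0 < q := by linarith
  have hdig := (quasiGreedy_one_spec hq).1.1.1
  set C : ℝ := alphaOne q / (q - 1)
  have hC : 0 ≤ C := div_nonneg (Nat.cast_nonneg _) (by linarith)
  have hstep : ∀ n, b n < alphaOne q → ∃ k m, b m < alphaOne q ∧
      baseValue q (fun i => b (n + 1 + i)) - 1
        < (baseValue q (fun i => b (m + 1 + i)) - 1) / q ^ (k + 1) := by
    intro n hn
    obtain ⟨k, hagree, hk⟩ := h n hn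
    refine ⟨k, n + 1 + k, hk.trans_le (hdig k), ?_⟩
    have := baseValue_sub_one_lt hq (fun i => hb (n + 1 + i)) hagree hk
    simpa only [add_assoc] using this
  have hbound : ∀ N n, b n < alphaOne q → baseValue q (fun i => b (n + 1 + i)) - 1 ≤ C / q ^ N := by
    intro N
    induction N with
    | zero =>
      intro n _
      have := baseValue_le hq (c := fun i => b (n + 1 + i)) fun i => hb _
      simp only [pow_zero, div_one]
      linarith
    | succ N ih =>
      intro n hn
      obtain ⟨k, m, hm, hlt⟩ := hstep n hn
      calc _ ≤ (baseValue q (fun i => b (m + 1 + i)) - 1) / q ^ (k + 1) := hlt.le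
        _ ≤ C / q ^ N / q ^ (k + 1) := by gcongr; exact ih m hm
        _ ≤ C / q ^ N / q ^ 1 := by gcongr <;> first | exact hq.le | omega
        _ = C / q ^ (N + 1) := by rw [div_div, ← pow_add]
  have hle : ∀ n, b n < alphaOne q → baseValue q (fun i => b (n + 1 + i)) - 1 ≤ 0 := fun n hn =>
    ge_of_tendsto' (Filter.Tendsto.div_atTop tendsto_const_nhds
      (tendsto_pow_atTop_atTop_of_one_lt hq)) fun N => hbound N n hn
  obtain ⟨k, m, hm, hlt⟩ := hstep n hn
  have := div_nonpos_of_nonpos_of_nonneg (hle m hm) (pow_nonneg hq0.le (k + 1))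
  linarith

end Parry

/-- Parry's characterization of greedy sequences.
A sequence `(b_i)` with digits in `{0, …, α₁}` is a greedy sequence in base `q`
(i.e. the greedy expansion of `x = ∑ b_i q^{-i}`) iff every shift after a digit
`b_n < α₁` is lexicographically smaller than `(α_i)`. -/
theorem greedy_iff_lex (q : ℝ) (hq : 1 < q) (b : ℕ → ℕ) (hb : ∀ i, b i ≤ alphaOne q) :
    IsGreedyOf q (∑' i, (b i : ℝ) / q ^ (i + 1)) b ↔
      ∀ n, b n < alphaOne q →
        LexLt (fun i => b (n + 1 + i)) (quasiGreedy q 1) := by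
  refine (isGreedyOf_iff_baseValue_lt_one hq hb).trans ⟨fun h n hn => ?_, fun h n hn => ?_⟩
  · exact lexLt_quasiGreedy_of_baseValue_lt_one hq (fun i => hb _) (h n hn)
  · exact baseValue_lt_one_of_lexLt hq hb h hn
end
end

section
/- Suppose q > 1 belongs to the closure of the set U of univoque numbers. Then the closure of U_q (in ℝ) equals V_q. -/
open Classical

noncomputable section

namespace UnivoqueExpansion

open Filter Topology

/-- The sequence `c` with its first `k` terms removed. -/
def tail (k : ℕ) (c : ℕ → ℕ) : ℕ → ℕ := fun i => c (k + i)

/-- The reflection of `c` with respect to the alphabet `{0, …, A}`. -/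
def conj (A : ℕ) (c : ℕ → ℕ) : ℕ → ℕ := fun i => A - c i

/-- The sequence `c` followed from index `n` on by `d`. -/
def splice (n : ℕ) (c d : ℕ → ℕ) : ℕ → ℕ := fun i => if i < n then c i else d (i - n)

/-- The value of the sequence `c` in base `q`. -/
def val (q : ℝ) (c : ℕ → ℕ) : ℝ := ∑' i, (c i : ℝ) / q ^ (i + 1)

/-! ### Sequences and the lexicographic order -/

lemma tail_zero (c : ℕ → ℕ) : tail 0 c = c := by
  funext i; simp [tail]

lemma tail_tail (m n : ℕ) (c : ℕ → ℕ) : tail n (tail m c) = tail (m + n) c := by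
  funext i; simp [tail, Nat.add_assoc]

lemma conj_conj {A : ℕ} {c : ℕ → ℕ} (hc : ∀ i, c i ≤ A) : conj A (conj A c) = c := by
  funext i
  have := hc i
  simp only [conj]
  omega

lemma conj_le (A : ℕ) (c : ℕ → ℕ) (i : ℕ) : conj A c i ≤ A := Nat.sub_le _ _

lemma lexLt_irrefl (a : ℕ → ℕ) : ¬ LexLt a a := fun ⟨_, _, h⟩ => lt_irrefl _ h

lemma lexLt_trans {a b c : ℕ → ℕ} (hab : LexLt a b) (hbc : LexLt b c) : LexLt a c := by
  obtain ⟨m, hm, hm'⟩ := hab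
  obtain ⟨n, hn, hn'⟩ := hbc
  rcases lt_trichotomy m n with h | h | h
  · exact ⟨m, fun i hi => (hm i hi).trans (hn i (hi.trans h)), by rw [← hn m h]; exact hm'⟩
  · subst h
    exact ⟨m, fun i hi => (hm i hi).trans (hn i hi), hm'.trans hn'⟩
  · exact ⟨n, fun i hi => (hm i (hi.trans h)).trans (hn i hi), by rw [hm n h]; exact hn'⟩

lemma lexLt_of_le_of_lt {a b c : ℕ → ℕ} (hab : LexLe a b) (hbc : LexLt b c) : LexLt a c := by
  rcases hab with h | rfl
  · exact lexLt_trans h hbc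
  · exact hbc

lemma lexLe_trans {a b c : ℕ → ℕ} (hab : LexLe a b) (hbc : LexLe b c) : LexLe a c := by
  rcases hbc with h | rfl
  · exact Or.inl (lexLt_of_le_of_lt hab h)
  · exact hab

lemma not_lexLt_of_lexLe {a b : ℕ → ℕ} (h : LexLe a b) : ¬ LexLt b a :=
  fun h' => lexLt_irrefl _ (lexLt_of_le_of_lt h h')

lemma lexLe_antisymm {a b : ℕ → ℕ} (h : LexLe a b) (h' : LexLe b a) : a = b := by
  rcases h with h | h
  · exact absurd h (not_lexLt_of_lexLe h')
  · exact h

lemma lexLt_trichotomy (a b : ℕ → ℕ) : LexLt a b ∨ a = b ∨ LexLt b a := by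
  by_cases h : a = b
  · exact Or.inr (Or.inl h)
  · have h' : ∃ n, a n ≠ b n := Function.ne_iff.mp h
    have hmin : ∀ i < Nat.find h', a i = b i := fun i hi => not_not.mp (Nat.find_min h' hi)
    rcases lt_or_gt_of_ne (Nat.find_spec h') with hl | hl
    · exact Or.inl ⟨_, hmin, hl⟩
    · exact Or.inr (Or.inr ⟨_, fun i hi => (hmin i hi).symm, hl⟩)

lemma lexLe_of_not_lexLt {a b : ℕ → ℕ} (h : ¬ LexLt b a) : LexLe a b := by
  rcases lexLt_trichotomy a b with h' | h' | h'
  · exact Or.inl h'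
  · exact Or.inr h'
  · exact absurd h' h

lemma lexLt_of_not_lexLe {a b : ℕ → ℕ} (h : ¬ LexLe b a) : LexLt a b := by
  by_contra h'
  exact h (lexLe_of_not_lexLt h')

lemma tendsto_nat_seq_iff {ι : Type*} {l : Filter ι} {u : ι → ℕ → ℕ} {a : ℕ → ℕ} :
    Tendsto u l (𝓝 a) ↔ ∀ N, ∀ᶠ n in l, ∀ i < N, u n i = a i := by
  rw [tendsto_pi_nhds]
  simp only [nhds_discrete, tendsto_pure]
  constructor
  · intro h N
    exact (Filter.eventually_all_finite (Set.finite_lt_nat N)).2 fun i _ => h i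
  · intro h i
    exact (h (i + 1)).mono fun n hn => hn i i.lt_succ_self

lemma lexLe_of_tendsto {u v : ℕ → ℕ → ℕ} {a b : ℕ → ℕ} (hu : Tendsto u atTop (𝓝 a))
    (hv : Tendsto v atTop (𝓝 b)) (h : ∀ᶠ n in atTop, LexLe (u n) (v n)) : LexLe a b := by
  apply lexLe_of_not_lexLt
  rintro ⟨N, hN, hN'⟩
  obtain ⟨n, hn, hun, hvn⟩ := (h.and ((tendsto_nat_seq_iff.1 hu (N + 1)).and
    (tendsto_nat_seq_iff.1 hv (N + 1)))).exists
  refine not_lexLt_of_lexLe hn ⟨N, fun i hi => ?_, ?_⟩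
  · rw [hun i (by omega), hvn i (by omega), hN i hi]
  · rwa [hun N (by omega), hvn N (by omega)]

lemma tendsto_tail {u : ℕ → ℕ → ℕ} {a : ℕ → ℕ} (hu : Tendsto u atTop (𝓝 a)) (k : ℕ) :
    Tendsto (fun n => tail k (u n)) atTop (𝓝 (tail k a)) :=
  tendsto_pi_nhds.2 fun i => tendsto_pi_nhds.1 hu (k + i)

lemma tendsto_conj {u : ℕ → ℕ → ℕ} {a : ℕ → ℕ} (hu : Tendsto u atTop (𝓝 a)) (A : ℕ) :
    Tendsto (fun n => conj A (u n)) atTop (𝓝 (conj A a)) :=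
  tendsto_pi_nhds.2 fun i =>
    (continuous_of_discreteTopology (f := fun m : ℕ => A - m)).continuousAt.tendsto.comp
      (tendsto_pi_nhds.1 hu i)

lemma infiniteSeq_tail {c : ℕ → ℕ} (h : InfiniteSeq c) (k : ℕ) : InfiniteSeq (tail k c) := by
  refine Set.infinite_of_forall_exists_gt fun n => ?_
  obtain ⟨m, hm, hmn⟩ := h.exists_gt (k + n)
  refine ⟨m - k, ?_, by omega⟩
  have : k + (m - k) = m := by omega
  simpa [tail, this] using hm

lemma exists_tail_eq_zero {c : ℕ → ℕ} (h : ¬ InfiniteSeq c) : ∃ K, ∀ i, K ≤ i → c i = 0 := by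
  obtain ⟨K, hK⟩ := (Set.not_infinite.1 h).bddAbove
  refine ⟨K + 1, fun i hi => ?_⟩
  by_contra hne
  have := hK hne
  omega

lemma exists_subseq_tendsto {A : ℕ} {u : ℕ → ℕ → ℕ} (hu : ∀ n i, u n i ≤ A) :
    ∃ c : ℕ → ℕ, (∀ i, c i ≤ A) ∧ ∃ φ : ℕ → ℕ, StrictMono φ ∧
      Tendsto (u ∘ φ) atTop (𝓝 c) := by
  have hK : IsCompact (Set.univ.pi fun _ : ℕ => Set.Iic A) :=
    isCompact_univ_pi fun _ => (Set.finite_Iic A).isCompact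
  obtain ⟨c, hc, φ, hφ, h⟩ := hK.tendsto_subseq (x := u) fun n i _ => hu n i
  exact ⟨c, fun i => hc i trivial, φ, hφ, h⟩

/-! ### Values of sequences -/

section Val

variable {q : ℝ} {A : ℕ} {c d : ℕ → ℕ}

lemma hasSum_geometric_div (hq : 1 < q) : HasSum (fun i : ℕ => 1 / q ^ (i + 1)) (1 / (q - 1)) := by
  have h := (hasSum_geometric_of_lt_one (r := q⁻¹) (by positivity)
    (inv_lt_one_of_one_lt₀ hq)).mul_left q⁻¹
  have h0 : q ≠ 0 := by positivity
  have h2 : q⁻¹ * (1 - q⁻¹)⁻¹ = 1 / (q - 1) := by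
    rw [← mul_inv, mul_sub, mul_inv_cancel₀ h0, mul_one, one_div]
  rw [h2] at h
  refine h.congr_fun fun i => ?_
  rw [pow_succ, one_div, mul_inv, inv_pow, mul_comm]

lemma hasSum_const_div (hq : 1 < q) (B : ℝ) :
    HasSum (fun i : ℕ => B / q ^ (i + 1)) (B / (q - 1)) := by
  have h := (hasSum_geometric_div hq).mul_left B
  simpa only [mul_one_div] using h

lemma summable_val (hq : 1 < q) (hc : ∀ i, c i ≤ A) :
    Summable fun i => (c i : ℝ) / q ^ (i + 1) := by
  refine Summable.of_nonneg_of_le (fun i => by positivity) (fun i => ?_)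
    (hasSum_const_div hq (A : ℝ)).summable
  have : (c i : ℝ) ≤ A := by exact_mod_cast hc i
  gcongr

lemma val_nonneg (hq : 1 < q) : 0 ≤ val q c := tsum_nonneg fun i => by positivity

lemma val_le (hq : 1 < q) (hc : ∀ i, c i ≤ A) : val q c ≤ A / (q - 1) := by
  rw [← (hasSum_const_div hq (A : ℝ)).tsum_eq]
  refine (summable_val hq hc).tsum_le_tsum (fun i => ?_) (hasSum_const_div hq (A : ℝ)).summable
  have : (c i : ℝ) ≤ A := by exact_mod_cast hc i
  gcongr

lemma val_pos (hq : 1 < q) (hc : ∀ i, c i ≤ A) (h : InfiniteSeq c) : 0 < val q c := by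
  obtain ⟨i, hi⟩ := h.nonempty
  refine (summable_val hq hc).tsum_pos (fun i => by positivity) i ?_
  have : (0 : ℝ) < c i := by exact_mod_cast Nat.pos_of_ne_zero hi
  positivity

lemma val_conj (hq : 1 < q) (hc : ∀ i, c i ≤ A) : val q (conj A c) = A / (q - 1) - val q c := by
  rw [← (hasSum_const_div hq (A : ℝ)).tsum_eq, val, val,
    ← (hasSum_const_div hq (A : ℝ)).summable.tsum_sub (summable_val hq hc)]
  congr 1
  funext i
  rw [conj, Nat.cast_sub (hc i), sub_div]

lemma val_succ (hq : 1 < q) (hc : ∀ i, c i ≤ A) :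
    q * val q c = c 0 + val q (tail 1 c) := by
  have h0 : q ≠ 0 := by positivity
  rw [val, (summable_val hq hc).tsum_eq_zero_add, mul_add, val, ← tsum_mul_left]
  congr 1
  · rw [zero_add, pow_one, mul_div_cancel₀ _ h0]
  · congr 1
    funext i
    rw [tail, add_comm 1 i, pow_succ q (i + 1)]
    field_simp

lemma val_sub_val (hq : 1 < q) (hc : ∀ i, c i ≤ A) (hd : ∀ i, d i ≤ A) (n : ℕ)
    (h : ∀ i < n, c i = d i) :
    q ^ n * (val q c - val q d) = val q (tail n c) - val q (tail n d) := by
  induction n with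
  | zero => simp [tail_zero]
  | succ n ih =>
    have h1 := ih fun i hi => h i (by omega)
    have hc' := val_succ (c := tail n c) hq fun i => hc _
    have hd' := val_succ (c := tail n d) hq fun i => hd _
    rw [tail_tail] at hc' hd'
    have h2 : tail n c 0 = tail n d 0 := h n (by omega)
    rw [h2] at hc'
    rw [pow_succ, mul_comm (q ^ n), mul_assoc, h1, mul_sub, hc', hd']
    ring

lemma val_sub_val_succ (hq : 1 < q) (hc : ∀ i, c i ≤ A) (hd : ∀ i, d i ≤ A) (n : ℕ)
    (h : ∀ i < n, c i = d i) :
    q ^ (n + 1) * (val q c - val q d) =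
      (c n - d n : ℝ) + (val q (tail (n + 1) c) - val q (tail (n + 1) d)) := by
  have h1 := val_sub_val hq hc hd n h
  have hc' := val_succ (c := tail n c) hq fun i => hc _
  have hd' := val_succ (c := tail n d) hq fun i => hd _
  rw [tail_tail] at hc' hd'
  rw [pow_succ, mul_comm (q ^ n), mul_assoc, h1, mul_sub, hc', hd']
  simp only [tail, Nat.add_zero]
  ring

lemma tendsto_val {u : ℕ → ℕ → ℕ} {p : ℕ → ℝ} (hq : 1 < q) (hp : Tendsto p atTop (𝓝 q))
    (hu : ∀ n i, u n i ≤ A) (h : Tendsto u atTop (𝓝 c)) :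
    Tendsto (fun n => val (p n) (u n)) atTop (𝓝 (val q c)) := by
  obtain ⟨r, hr1, hrq⟩ := exists_between hq
  refine tendsto_tsum_of_dominated_convergence (bound := fun i : ℕ => (A : ℝ) / r ^ (i + 1))
    (hasSum_const_div hr1 (A : ℝ)).summable (fun i => ?_) ?_
  · refine Tendsto.div ?_ (hp.pow _) (by positivity)
    exact (continuous_of_discreteTopology (f := fun m : ℕ => (m : ℝ))).continuousAt.tendsto.comp
      (tendsto_pi_nhds.1 h i)
  · filter_upwards [hp.eventually (lt_mem_nhds hrq)] with n hn i
    have h1 : (u n i : ℝ) ≤ A := by exact_mod_cast hu n i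
    have h2 : 0 < r := by positivity
    have h3 : 0 < p n := h2.trans hn
    rw [Real.norm_of_nonneg (by positivity)]
    gcongr

end Val

/-! ### The alphabet and the quasi-greedy expansion -/

section Base

variable {q x : ℝ} {c d : ℕ → ℕ}

lemma alphaOne_cast (hq : 1 < q) : (alphaOne q : ℝ) = ⌈q⌉ - 1 := by
  have h : 0 ≤ ⌈q⌉ - 1 := by
    have : 1 < ⌈q⌉ := Int.lt_ceil.2 (by exact_mod_cast hq)
    omega
  rw [alphaOne, ← Int.cast_natCast, Int.toNat_of_nonneg h]
  push_cast
  rfl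

lemma alphaOne_lt (hq : 1 < q) : (alphaOne q : ℝ) < q := by
  rw [alphaOne_cast hq]
  linarith [Int.ceil_lt_add_one q]

lemma le_alphaOne_add_one (hq : 1 < q) : q ≤ alphaOne q + 1 := by
  rw [alphaOne_cast hq]
  linarith [Int.le_ceil q]

lemma alphaOne_pos (hq : 1 < q) : 0 < alphaOne q := by
  have := le_alphaOne_add_one hq
  have h : (0 : ℝ) < alphaOne q := by linarith
  exact_mod_cast h

lemma one_le_alphaOne_div (hq : 1 < q) : 1 ≤ (alphaOne q : ℝ) / (q - 1) := by
  rw [le_div_iff₀ (by linarith)]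
  linarith [le_alphaOne_add_one hq]

lemma isExpansionOf_iff : IsExpansionOf q x c ↔ (∀ i, c i ≤ alphaOne q) ∧ x = val q c := Iff.rfl

lemma mem_Jq_of_isExpansionOf (hq : 1 < q) (h : IsExpansionOf q x c) : x ∈ Jq q := by
  rw [(isExpansionOf_iff.1 h).2]
  exact ⟨val_nonneg hq, val_le hq h.1⟩

/-- The remainders of the quasi-greedy algorithm started at `x`. -/
def remainder (q x : ℝ) : ℕ → ℝ
  | 0 => x
  | n + 1 => q * remainder q x n - (min (alphaOne q : ℤ) (⌈q * remainder q x n⌉ - 1) : ℤ)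

lemma remainder_mem (hq : 1 < q) (hx : 0 < x) (hx' : x ≤ alphaOne q / (q - 1)) (n : ℕ) :
    0 < remainder q x n ∧ remainder q x n ≤ alphaOne q / (q - 1) := by
  induction n with
  | zero => exact ⟨hx, hx'⟩
  | succ n ih =>
    obtain ⟨h1, h2⟩ := ih
    set r := remainder q x n with hr
    have h3 : remainder q x (n + 1) = q * r - (min (alphaOne q : ℤ) (⌈q * r⌉ - 1) : ℤ) := rfl
    have h4 : 0 < q - 1 := by linarith
    rcases le_total (alphaOne q : ℤ) (⌈q * r⌉ - 1) with h | h
    · rw [h3, min_eq_left h]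
      have h5 : ((alphaOne q : ℤ) : ℝ) ≤ ⌈q * r⌉ - 1 := by exact_mod_cast h
      rw [le_div_iff₀ h4] at h2 ⊢
      push_cast at h5 ⊢
      refine ⟨by linarith [Int.ceil_lt_add_one (q * r)], by nlinarith⟩
    · rw [h3, min_eq_right h]
      push_cast
      refine ⟨by linarith [Int.ceil_lt_add_one (q * r)], ?_⟩
      linarith [Int.le_ceil (q * r), one_le_alphaOne_div hq]

lemma exists_expansion_tail_le_one (hq : 1 < q) (hx : 0 < x) (hx' : x ≤ alphaOne q / (q - 1)) :
    ∃ c, IsExpansionOf q x c ∧ InfiniteSeq c ∧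
      ∀ n, c n < alphaOne q → val q (tail (n + 1) c) ≤ 1 := by
  set r := remainder q x with hr
  have hmem := remainder_mem hq hx hx'
  have hq0 : 0 < q := by linarith
  set e : ℕ → ℤ := fun n => min (alphaOne q : ℤ) (⌈q * r n⌉ - 1) with he
  have he0 : ∀ n, 0 ≤ e n := fun n => by
    have : 0 < ⌈q * r n⌉ := Int.ceil_pos.2 (mul_pos hq0 (hmem n).1)
    exact le_min (by positivity) (by omega)
  set c : ℕ → ℕ := fun n => (e n).toNat with hc
  have hce : ∀ n, (c n : ℝ) = e n := fun n => by
    rw [← Int.cast_natCast, hc, Int.toNat_of_nonneg (he0 n)]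
  have hcA : ∀ i, c i ≤ alphaOne q := fun i => by
    have : e i ≤ alphaOne q := min_le_left _ _
    simp only [hc]
    omega
  have hrs : ∀ n, r (n + 1) = q * r n - c n := fun n => by rw [hce]; rfl
  have hsum : ∀ n, q ^ n * (val q c - x) = val q (tail n c) - r n := fun n => by
    induction n with
    | zero => simp [tail_zero, hr, remainder]
    | succ n ih =>
      have h := val_succ (c := tail n c) hq fun i => hcA _
      rw [tail_tail, tail, Nat.add_zero] at h
      rw [pow_succ, mul_comm (q ^ n), mul_assoc, ih, mul_sub, h, hrs]
      ring
  have hval : val q c = x := by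
    by_contra hne
    have hpos : 0 < |val q c - x| := abs_pos.2 (sub_ne_zero.2 hne)
    obtain ⟨n, hn⟩ := pow_unbounded_of_one_lt
      (((alphaOne q : ℝ) / (q - 1)) / |val q c - x|) hq
    rw [div_lt_iff₀ hpos, ← abs_of_pos (pow_pos hq0 n), ← abs_mul, hsum] at hn
    refine absurd hn (not_lt.2 (abs_le.2 ⟨?_, ?_⟩))
    · linarith [(hmem n).2, val_nonneg (c := tail n c) hq]
    · linarith [(hmem n).1, val_le (c := tail n c) hq fun i => hcA _]
  have htail : ∀ n, val q (tail n c) = r n := fun n => by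
    have := hsum n
    rw [hval] at this
    linarith
  refine ⟨c, isExpansionOf_iff.2 ⟨hcA, hval.symm⟩, ?_, fun n hn => ?_⟩
  · by_contra hinf
    obtain ⟨K, hK⟩ := exists_tail_eq_zero hinf
    have h1 := htail K
    have h2 : val q (tail K c) = 0 := by
      simp [val, tail, hK]
    linarith [(hmem K).1]
  · rw [htail, hrs, hce]
    have h1 : e n < alphaOne q := by
      simp only [hc] at hn
      omega
    have h2 : e n = ⌈q * r n⌉ - 1 := by
      rcases min_choice (alphaOne q : ℤ) (⌈q * r n⌉ - 1) with h | h
      · exact absurd h h1.ne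
      · exact h
    rw [h2]
    push_cast
    linarith [Int.le_ceil (q * r n)]

lemma isQuasiGreedyOf_of_tail_le_one (hq : 1 < q) (hc : IsExpansionOf q x c) (hinf : InfiniteSeq c)
    (h : ∀ n, c n < alphaOne q → val q (tail (n + 1) c) ≤ 1) : IsQuasiGreedyOf q x c := by
  refine ⟨hc, hinf, fun d hd hdinf => lexLe_of_not_lexLt ?_⟩
  rintro ⟨n, hn, hn'⟩
  have h1 := val_sub_val_succ hq hd.1 hc.1 n fun i hi => (hn i hi).symm
  rw [← (isExpansionOf_iff.1 hc).2, ← (isExpansionOf_iff.1 hd).2, sub_self, mul_zero] at h1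
  have h2 := h n (hn'.trans_le (hd.1 n))
  have h3 : 0 < val q (tail (n + 1) d) := val_pos hq (fun i => hd.1 _) (infiniteSeq_tail hdinf _)
  have h4 : (c n + 1 : ℝ) ≤ d n := by exact_mod_cast hn'
  linarith

lemma isQuasiGreedyOf_unique (hc : IsQuasiGreedyOf q x c) (hd : IsQuasiGreedyOf q x d) : c = d :=
  lexLe_antisymm (hd.2.2 c hc.1 hc.2.1) (hc.2.2 d hd.1 hd.2.1)

lemma quasiGreedy_eq_of_isQuasiGreedyOf (hc : IsQuasiGreedyOf q x c) : quasiGreedy q x = c := by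
  have h : ∃ a, IsQuasiGreedyOf q x a := ⟨c, hc⟩
  rw [quasiGreedy, dif_pos h]
  exact isQuasiGreedyOf_unique h.choose_spec hc

lemma quasiGreedy_spec (hq : 1 < q) (hx : 0 < x) (hx' : x ≤ alphaOne q / (q - 1)) :
    IsExpansionOf q x (quasiGreedy q x) ∧ InfiniteSeq (quasiGreedy q x) ∧
      ∀ n, quasiGreedy q x n < alphaOne q → val q (tail (n + 1) (quasiGreedy q x)) ≤ 1 := by
  obtain ⟨c, h1, h2, h3⟩ := exists_expansion_tail_le_one hq hx hx'
  rw [quasiGreedy_eq_of_isQuasiGreedyOf (isQuasiGreedyOf_of_tail_le_one hq h1 h2 h3)]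
  exact ⟨h1, h2, h3⟩

lemma quasiGreedy_zero (hq : 1 < q) : quasiGreedy q 0 = fun _ => 0 := by
  refine dif_neg ?_
  rintro ⟨a, ha, hinf, -⟩
  have := val_pos hq ha.1 hinf
  rw [← (isExpansionOf_iff.1 ha).2] at this
  exact lt_irrefl _ this

lemma exists_isExpansionOf (hq : 1 < q) (hx : x ∈ Jq q) : ∃ c, IsExpansionOf q x c := by
  rcases hx.1.eq_or_lt with rfl | h
  · exact ⟨fun _ => 0, isExpansionOf_iff.2 ⟨fun _ => Nat.zero_le _, by simp [val]⟩⟩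
  · exact ⟨_, (quasiGreedy_spec hq h hx.2).1⟩

lemma quasiGreedy_one_spec (hq : 1 < q) :
    IsExpansionOf q 1 (quasiGreedy q 1) ∧ InfiniteSeq (quasiGreedy q 1) ∧
      ∀ n, quasiGreedy q 1 n < alphaOne q → val q (tail (n + 1) (quasiGreedy q 1)) ≤ 1 :=
  quasiGreedy_spec hq one_pos (one_le_alphaOne_div hq)

lemma quasiGreedy_one_le (hq : 1 < q) (i : ℕ) : quasiGreedy q 1 i ≤ alphaOne q :=
  (quasiGreedy_one_spec hq).1.1 i

lemma val_quasiGreedy_one (hq : 1 < q) : val q (quasiGreedy q 1) = 1 :=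
  (isExpansionOf_iff.1 (quasiGreedy_one_spec hq).1).2.symm

/-! ### Lexicographic comparison with the quasi-greedy expansion of `1` -/

lemma lexLe_quasiGreedy_one (hq : 1 < q) (hc : ∀ i, c i ≤ alphaOne q) (hinf : InfiniteSeq c)
    (h : val q c ≤ 1) : LexLe c (quasiGreedy q 1) := by
  refine lexLe_of_not_lexLt ?_
  rintro ⟨n, hn, hn'⟩
  have h1 := val_sub_val_succ hq hc (quasiGreedy_one_le hq) n fun i hi => (hn i hi).symm
  have h2 := (quasiGreedy_one_spec hq).2.2 n (hn'.trans_le (hc n))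
  have h3 : 0 < val q (tail (n + 1) c) := val_pos hq (fun _ => hc _) (infiniteSeq_tail hinf _)
  have h4 : (quasiGreedy q 1 n + 1 : ℝ) ≤ c n := by exact_mod_cast hn'
  have h5 : q ^ (n + 1) * (val q c - val q (quasiGreedy q 1)) ≤ 0 :=
    mul_nonpos_of_nonneg_of_nonpos (by positivity) (by rw [val_quasiGreedy_one hq]; linarith)
  linarith

lemma lexLt_quasiGreedy_one (hq : 1 < q) (hc : ∀ i, c i ≤ alphaOne q)
    (h : val q c < 1) : LexLt c (quasiGreedy q 1) := by
  refine lexLt_of_not_lexLe ?_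
  rintro (⟨n, hn, hn'⟩ | rfl)
  · have h1 := val_sub_val_succ hq hc (quasiGreedy_one_le hq) n fun i hi => (hn i hi).symm
    have h2 := (quasiGreedy_one_spec hq).2.2 n (hn'.trans_le (hc n))
    have h3 : 0 ≤ val q (tail (n + 1) c) := val_nonneg hq
    have h4 : (quasiGreedy q 1 n + 1 : ℝ) ≤ c n := by exact_mod_cast hn'
    have h5 : q ^ (n + 1) * (val q c - val q (quasiGreedy q 1)) < 0 :=
      mul_neg_of_pos_of_neg (by positivity) (by rw [val_quasiGreedy_one hq]; linarith)
    linarith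
  · exact h.ne (val_quasiGreedy_one hq)

/-- The weak upper lexicographic condition on a sequence `c`. -/
def UpperLe (q : ℝ) (c : ℕ → ℕ) : Prop :=
  ∀ n, c n < alphaOne q → LexLe (tail (n + 1) c) (quasiGreedy q 1)

/-- The strict upper lexicographic condition on a sequence `c`. -/
def UpperLt (q : ℝ) (c : ℕ → ℕ) : Prop :=
  ∀ n, c n < alphaOne q → LexLt (tail (n + 1) c) (quasiGreedy q 1)

lemma UpperLt.upperLe (h : UpperLt q c) : UpperLe q c := fun n hn => Or.inl (h n hn)

lemma UpperLe.shift (h : UpperLe q c) (k : ℕ) : UpperLe q (tail k c) := fun n hn => by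
  rw [tail_tail]
  exact h (k + n) hn

/-- One step of comparison of a lexicographically smaller sequence with `1`. -/
lemma exists_one_sub_val_tail_lt (hq : 1 < q) (hc : ∀ i, c i ≤ alphaOne q)
    (h : LexLt c (quasiGreedy q 1)) : ∃ n, c n < alphaOne q ∧
      1 - val q (tail (n + 1) c) < q ^ (n + 1) * (1 - val q c) := by
  obtain ⟨n, hn, hn'⟩ := h
  refine ⟨n, hn'.trans_le (quasiGreedy_one_le hq n), ?_⟩
  have h1 := val_sub_val_succ hq (quasiGreedy_one_le hq) hc n fun i hi => (hn i hi).symm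
  have h2 : 0 < val q (tail (n + 1) (quasiGreedy q 1)) :=
    val_pos hq (fun _ => quasiGreedy_one_le hq _) (infiniteSeq_tail (quasiGreedy_one_spec hq).2.1 _)
  have h3 : (c n + 1 : ℝ) ≤ quasiGreedy q 1 n := by exact_mod_cast hn'
  rw [val_quasiGreedy_one hq] at h1
  linarith

lemma UpperLe.val_le_one (hq : 1 < q) (hc : ∀ i, c i ≤ alphaOne q) (h : UpperLe q c)
    (hle : LexLe c (quasiGreedy q 1)) : val q c ≤ 1 := by
  set B : ℝ := alphaOne q / (q - 1) with hB
  have key : ∀ N : ℕ, ∀ c : ℕ → ℕ, (∀ i, c i ≤ alphaOne q) → UpperLe q c →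
      LexLe c (quasiGreedy q 1) → q ^ N * (val q c - 1) ≤ B := by
    intro N
    induction N with
    | zero =>
      intro c hc _ _
      have := val_le hq hc
      rw [pow_zero, one_mul]
      linarith
    | succ N ih =>
      intro c hc h hle
      rcases hle with hlt | rfl
      · obtain ⟨n, hn, hn'⟩ := exists_one_sub_val_tail_lt hq hc hlt
        have h1 := ih (tail (n + 1) c) (fun i => hc _) (h.shift _) (h n hn)
        by_cases hv : val q c ≤ 1
        · have h2 : q ^ (N + 1) * (val q c - 1) ≤ 0 :=
            mul_nonpos_of_nonneg_of_nonpos (by positivity) (by linarith)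
          have := one_le_alphaOne_div hq
          linarith
        · have h3 : q * (val q c - 1) ≤ q ^ (n + 1) * (val q c - 1) := by
            refine mul_le_mul_of_nonneg_right (le_self_pow₀ hq.le n.succ_ne_zero) ?_
            linarith [not_le.1 hv]
          have h4 : q ^ N * (q * (val q c - 1)) ≤
              q ^ N * (val q (tail (n + 1) c) - 1) :=
            mul_le_mul_of_nonneg_left (by linarith) (by positivity)
          rw [pow_succ, mul_assoc]
          exact h4.trans h1
      · rw [val_quasiGreedy_one hq, sub_self, mul_zero]
        have := one_le_alphaOne_div hq
        linarith
  by_contra hv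
  have hpos : 0 < val q c - 1 := by linarith [not_le.1 hv]
  obtain ⟨N, hN⟩ := pow_unbounded_of_one_lt (B / (val q c - 1)) hq
  rw [div_lt_iff₀ hpos] at hN
  exact absurd (key N c hc h hle) (not_le.2 hN)

lemma UpperLe.val_tail_le_one (hq : 1 < q) (hc : ∀ i, c i ≤ alphaOne q) (h : UpperLe q c) {n : ℕ}
    (hn : c n < alphaOne q) : val q (tail (n + 1) c) ≤ 1 :=
  (h.shift (n + 1)).val_le_one hq (fun _ => hc _) (h n hn)

lemma UpperLt.val_tail_lt_one (hq : 1 < q) (hc : ∀ i, c i ≤ alphaOne q) (h : UpperLt q c) {n : ℕ}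
    (hn : c n < alphaOne q) : val q (tail (n + 1) c) < 1 := by
  obtain ⟨m, hm, hm'⟩ := exists_one_sub_val_tail_lt hq (fun i => hc (n + 1 + i)) (h n hn)
  have h1 := UpperLe.val_tail_le_one hq (fun i => hc (n + 1 + i)) (h.upperLe.shift (n + 1)) hm
  have h2 : 0 < q ^ (m + 1) * (1 - val q (tail (n + 1) c)) :=
    lt_of_le_of_lt (by linarith) hm'
  have h3 := pos_of_mul_pos_right h2 (by positivity)
  linarith

lemma UpperLe.isQuasiGreedyOf (hq : 1 < q) (hc : IsExpansionOf q x c) (hinf : InfiniteSeq c)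
    (h : UpperLe q c) : IsQuasiGreedyOf q x c :=
  isQuasiGreedyOf_of_tail_le_one hq hc hinf fun _ hn => h.val_tail_le_one hq hc.1 hn

lemma upperLe_quasiGreedy (hq : 1 < q) (hx : 0 < x) (hx' : x ≤ alphaOne q / (q - 1)) :
    UpperLe q (quasiGreedy q x) := fun n hn => by
  obtain ⟨h1, h2, h3⟩ := quasiGreedy_spec hq hx hx'
  exact lexLe_quasiGreedy_one hq (fun _ => h1.1 _) (infiniteSeq_tail h2 _) (h3 n hn)

/-! ### Unique expansions -/

lemma UpperLt.lexLe_of_val_eq (hq : 1 < q) (hc : ∀ i, c i ≤ alphaOne q)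
    (hd : ∀ i, d i ≤ alphaOne q) (h : UpperLt q c) (he : val q d = val q c) : LexLe d c := by
  refine lexLe_of_not_lexLt ?_
  rintro ⟨n, hn, hn'⟩
  have h1 := val_sub_val_succ hq hd hc n fun i hi => (hn i hi).symm
  rw [he, sub_self, mul_zero] at h1
  have h2 := h.val_tail_lt_one hq hc (hn'.trans_le (hd n))
  have h3 : 0 ≤ val q (tail (n + 1) d) := val_nonneg hq
  have h4 : (c n + 1 : ℝ) ≤ d n := by exact_mod_cast hn'
  linarith

lemma eq_of_lexLe_conj {A : ℕ} (hc : ∀ i, c i ≤ A) (h : LexLe d c)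
    (h' : LexLe (conj A d) (conj A c)) : d = c := by
  rcases h with ⟨n, hn, hn'⟩ | h
  · refine absurd ⟨n, fun i hi => ?_, ?_⟩ (not_lexLt_of_lexLe h')
    · simp only [conj, hn i hi]
    · have := hc n
      simp only [conj]
      omega
  · exact h

lemma val_mem_Uq (hq : 1 < q) (hc : ∀ i, c i ≤ alphaOne q) (h : UpperLt q c)
    (h' : UpperLt q (conj (alphaOne q) c)) : val q c ∈ Uq q := by
  refine ⟨c, isExpansionOf_iff.2 ⟨hc, rfl⟩, fun d hd => ?_⟩
  have he : val q d = val q c := (isExpansionOf_iff.1 hd).2.symm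
  refine eq_of_lexLe_conj hc (h.lexLe_of_val_eq hq hc hd.1 he) ?_
  refine h'.lexLe_of_val_eq hq (conj_le _ _) (conj_le _ _) ?_
  rw [val_conj hq hc, val_conj hq hd.1, he]

lemma isExpansionOf_conj (hq : 1 < q) (hc : IsExpansionOf q x c) :
    IsExpansionOf q (alphaOne q / (q - 1) - x) (conj (alphaOne q) c) :=
  isExpansionOf_iff.2 ⟨conj_le _ _, by rw [val_conj hq hc.1, ← (isExpansionOf_iff.1 hc).2]⟩

lemma existsUnique_conj (hq : 1 < q) (h : ∃! c, IsExpansionOf q x c) :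
    ∃! c, IsExpansionOf q (alphaOne q / (q - 1) - x) c := by
  obtain ⟨c, hc, huniq⟩ := h
  refine ⟨conj (alphaOne q) c, isExpansionOf_conj hq hc, fun d hd => ?_⟩
  have h1 := isExpansionOf_conj hq hd
  rw [sub_sub_cancel] at h1
  rw [← huniq _ h1, conj_conj hd.1]

/-- Digits of a unique expansion cannot be increased. -/
lemma val_tail_lt_one_of_unique (hq : 1 < q) (hx : ∃! c, IsExpansionOf q x c)
    (hc : IsExpansionOf q x c) {n : ℕ} (hn : c n < alphaOne q) : val q (tail (n + 1) c) < 1 := by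
  by_contra hge
  have hmem : val q (tail (n + 1) c) - 1 ∈ Jq q :=
    ⟨by linarith [not_lt.1 hge], by linarith [val_le (c := tail (n + 1) c) hq fun i => hc.1 _]⟩
  obtain ⟨e, he⟩ := exists_isExpansionOf hq hmem
  set d : ℕ → ℕ := fun i => if i < n then c i else if i = n then c n + 1 else e (i - (n + 1))
    with hd
  have hdA : ∀ i, d i ≤ alphaOne q := fun i => by
    simp only [hd]
    split_ifs
    · exact hc.1 i
    · exact hn
    · exact he.1 _
  have h1 := val_sub_val_succ hq hdA hc.1 n fun i hi => by simp [hd, hi]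
  have h2 : tail (n + 1) d = e := by
    funext i
    have h3 : ¬ n + 1 + i < n := by omega
    have h4 : n + 1 + i ≠ n := by omega
    have h5 : n + 1 + i - (n + 1) = i := by omega
    simp only [tail, hd, h3, h4, if_false, h5]
  have h6 : d n = c n + 1 := by simp [hd]
  rw [h2, h6, ← (isExpansionOf_iff.1 he).2] at h1
  push_cast at h1
  have h7 : q ^ (n + 1) * (val q d - val q c) = 0 := by rw [h1]; ring
  have h8 : val q d = val q c := by
    have := (mul_eq_zero.1 h7).resolve_left (by positivity)
    linarith
  have h9 : IsExpansionOf q x d :=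
    isExpansionOf_iff.2 ⟨hdA, by rw [h8]; exact (isExpansionOf_iff.1 hc).2⟩
  have h10 := congrFun (hx.unique h9 hc) n
  omega

lemma upperLt_of_unique (hq : 1 < q) (hx : ∃! c, IsExpansionOf q x c)
    (hc : IsExpansionOf q x c) : UpperLt q c := fun _ hn =>
  lexLt_quasiGreedy_one hq (fun _ => hc.1 _) (val_tail_lt_one_of_unique hq hx hc hn)

end Base

/-! ### Bases in the closure of the univoque numbers -/

section Univoque

variable {q : ℝ}

lemma lexLe_tail_quasiGreedy_one (hq : 1 < q) (k : ℕ) :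
    LexLe (tail k (quasiGreedy q 1)) (quasiGreedy q 1) := by
  obtain ⟨h1, h2, h3⟩ := quasiGreedy_one_spec hq
  refine lexLe_quasiGreedy_one hq (fun _ => h1.1 _) (infiniteSeq_tail h2 k) ?_
  induction k with
  | zero => rw [tail_zero, val_quasiGreedy_one hq]
  | succ k ih =>
    rcases (h1.1 k).lt_or_eq with h | h
    · exact h3 k h
    · have h4 := val_succ (c := tail k (quasiGreedy q 1)) hq fun _ => h1.1 _
      rw [tail_tail, tail, Nat.add_zero, h] at h4
      have := le_alphaOne_add_one hq
      nlinarith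

lemma quasiGreedy_one_zero (hq : 1 < q) : quasiGreedy q 1 0 = alphaOne q := by
  obtain ⟨h1, h2, h3⟩ := quasiGreedy_one_spec hq
  by_contra hne
  have hlt := lt_of_le_of_ne (h1.1 0) hne
  have h4 := val_succ hq h1.1
  rw [val_quasiGreedy_one hq] at h4
  have h5 := h3 0 hlt
  have h6 : (quasiGreedy q 1 0 + 1 : ℝ) ≤ alphaOne q := by exact_mod_cast hlt
  have := alphaOne_lt hq
  rw [zero_add] at h5
  linarith

/-- Every proper tail of the quasi-greedy expansion of `1` has a reflection smaller than the
expansion itself. -/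
def ConjTailLt (q : ℝ) : Prop :=
  ∀ k, 1 ≤ k → LexLt (conj (alphaOne q) (tail k (quasiGreedy q 1))) (quasiGreedy q 1)

lemma conjTailLt_of_mem_USet (h : q ∈ USet) : ConjTailLt q := by
  obtain ⟨hq, hu⟩ := h
  have h1 := (quasiGreedy_one_spec hq).1
  have hconj := isExpansionOf_conj hq h1
  have huconj := existsUnique_conj hq hu
  have key : ∀ k, val q (conj (alphaOne q) (tail (k + 1) (quasiGreedy q 1))) < 1 := fun k => by
    induction k with
    | zero =>
      refine val_tail_lt_one_of_unique hq huconj hconj (n := 0) ?_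
      have := alphaOne_pos hq
      rw [conj, quasiGreedy_one_zero hq]
      omega
    | succ k ih =>
      rcases Nat.eq_zero_or_pos (quasiGreedy q 1 (k + 1)) with h | h
      · have h4 := val_succ (c := conj (alphaOne q) (tail (k + 1) (quasiGreedy q 1))) hq
          (conj_le _ _)
        have h5 : tail 1 (conj (alphaOne q) (tail (k + 1) (quasiGreedy q 1))) =
            conj (alphaOne q) (tail (k + 1 + 1) (quasiGreedy q 1)) := by
          rw [← tail_tail (k + 1) 1]; rfl
        have h6 : conj (alphaOne q) (tail (k + 1) (quasiGreedy q 1)) 0 = alphaOne q := by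
          simp [conj, tail, h]
        rw [h5, h6] at h4
        have := le_alphaOne_add_one hq
        nlinarith
      · refine val_tail_lt_one_of_unique hq huconj hconj (n := k + 1) ?_
        have := alphaOne_pos hq
        rw [conj]
        omega
  intro k hk
  obtain ⟨k, rfl⟩ := Nat.exists_eq_add_of_le' hk
  exact lexLt_quasiGreedy_one hq (conj_le _ _) (key k)

lemma conjTailLt_of_eq_add_one (hq : 1 < q) (h : q = alphaOne q + 1) : ConjTailLt q := by
  have hA := alphaOne_pos hq
  have h1 : IsQuasiGreedyOf q 1 (fun _ => alphaOne q) := by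
    refine isQuasiGreedyOf_of_tail_le_one hq (isExpansionOf_iff.2 ⟨fun _ => le_rfl, ?_⟩) ?_
      fun _ hn => absurd hn (lt_irrefl _)
    · have h0 : (0 : ℝ) < alphaOne q := by exact_mod_cast hA
      have h2 : q - 1 = alphaOne q := by linarith
      rw [val, (hasSum_const_div hq (alphaOne q : ℝ)).tsum_eq, h2, div_self h0.ne']
    · have : {i : ℕ | (fun _ => alphaOne q) i ≠ 0} = Set.univ :=
        Set.eq_univ_of_forall fun _ => hA.ne'
      rw [InfiniteSeq, this]
      exact Set.infinite_univ
  intro k _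
  rw [quasiGreedy_eq_of_isQuasiGreedyOf h1]
  exact ⟨0, fun i hi => absurd hi (Nat.not_lt_zero _), by simpa [conj, tail] using hA⟩

lemma eventually_alphaOne_eq (hq : 1 < q) (h : q ≠ alphaOne q + 1) :
    ∀ᶠ p in 𝓝 q, alphaOne p = alphaOne q := by
  have h1 : (⌈q⌉ : ℝ) - 1 < q := by linarith [Int.ceil_lt_add_one q]
  have h2 : q < ⌈q⌉ := by
    refine lt_of_le_of_ne (Int.le_ceil q) fun h2 => h ?_
    rw [alphaOne_cast hq]
    linarith
  filter_upwards [Ioo_mem_nhds h1 h2] with p hp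
  have : ⌈p⌉ = ⌈q⌉ := Int.ceil_eq_iff.2 ⟨hp.1, hp.2.le⟩
  rw [alphaOne, alphaOne, this]

/-- If the reflected tail of `a` from index `k` is `a` itself and `d` agrees with `a` on the first
`2 * k` terms, then `d` is not the expansion of `1` in a univoque base. -/
lemma false_of_conj_tail_eq {A k : ℕ} {a d : ℕ → ℕ} (hk : 1 ≤ k) (ha : ∀ i, a i ≤ A)
    (hak : conj A (tail k a) = a) (had : ∀ i < 2 * k, d i = a i)
    (h1 : ∀ j, LexLe (tail j d) d) (h2 : LexLt (conj A (tail k d)) d) : False := by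
  have hak' : ∀ i, A - a (k + i) = a i := fun i => congrFun hak i
  have hper : ∀ i, a (2 * k + i) = a i := fun i => by
    have e1 := hak' i
    have e2 := hak' (k + i)
    have e3 := ha (2 * k + i)
    have e4 := ha i
    rw [show k + (k + i) = 2 * k + i by ring] at e2
    omega
  rcases lexLt_trichotomy d a with ⟨N, hN, hN'⟩ | rfl | ⟨N, hN, hN'⟩
  · have hkN : 2 * k ≤ N := by
      by_contra h
      exact hN'.ne (had N (by omega))
    refine not_lexLt_of_lexLe (Or.inl h2) ⟨N - k, fun i hi => ?_, ?_⟩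
    · rw [hN i (by omega), conj, tail, hN (k + i) (by omega), hak']
    · have e1 := hak' (N - k)
      have e2 := ha N
      rw [show k + (N - k) = N by omega] at e1
      rw [conj, tail, show k + (N - k) = N by omega, hN (N - k) (by omega)]
      omega
  · rw [hak] at h2
    exact lexLt_irrefl _ h2
  · have hkN : 2 * k ≤ N := by
      by_contra h
      exact hN'.ne (had N (by omega)).symm
    refine not_lexLt_of_lexLe (h1 (2 * k)) ⟨N - 2 * k, fun i hi => ?_, ?_⟩
    · rw [← hN i (by omega), tail, ← hN (2 * k + i) (by omega), hper]
    · have e1 := hper (N - 2 * k)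
      rw [show 2 * k + (N - 2 * k) = N by omega] at e1
      rw [tail, show 2 * k + (N - 2 * k) = N by omega, ← hN (N - 2 * k) (by omega), ← e1]
      exact hN'

lemma conjTailLt_of_mem_closure (hq : 1 < q) (h : q ∈ closure USet) : ConjTailLt q := by
  by_cases hint : q = alphaOne q + 1
  · exact conjTailLt_of_eq_add_one hq hint
  have h' : q ∈ closure (USet ∩ {p | alphaOne p = alphaOne q}) :=
    mem_closure_iff_nhds.2 fun t ht => by
      obtain ⟨p, hp, hpU⟩ := mem_closure_iff_nhds.1 h _
        (Filter.inter_mem ht (eventually_alphaOne_eq hq hint))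
      exact ⟨p, hp.1, hpU, hp.2⟩
  obtain ⟨p, hp, hpq⟩ := mem_closure_iff_seq_limit.1 h'
  set A := alphaOne q with hA
  have hA0 : 0 < A := alphaOne_pos hq
  set u : ℕ → ℕ → ℕ := fun n => quasiGreedy (p n) 1 with hu
  have hp1 : ∀ n, 1 < p n := fun n => (hp n).1.1
  have hpA : ∀ n, alphaOne (p n) = A := fun n => (hp n).2
  have huA : ∀ n i, u n i ≤ A := fun n i => by
    rw [← hpA n]
    exact quasiGreedy_one_le (hp1 n) i
  have hu1 : ∀ n k, LexLe (tail k (u n)) (u n) := fun n => lexLe_tail_quasiGreedy_one (hp1 n)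
  have hu2 : ∀ n k, 1 ≤ k → LexLt (conj A (tail k (u n))) (u n) := fun n => by
    rw [← hpA n]
    exact conjTailLt_of_mem_USet (hp n).1
  obtain ⟨c, hcA, φ, hφ, hc⟩ := exists_subseq_tendsto huA
  have hc1 : ∀ k, LexLe (tail k c) c := fun k =>
    lexLe_of_tendsto (tendsto_tail hc k) hc (Eventually.of_forall fun n => hu1 _ k)
  have hc2 : ∀ k, 1 ≤ k → LexLe (conj A (tail k c)) c := fun k hk =>
    lexLe_of_tendsto (tendsto_conj (tendsto_tail hc k) A) hc
      (Eventually.of_forall fun n => Or.inl (hu2 _ k hk))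
  have hval : val q c = 1 := by
    have h1 := tendsto_val (p := p ∘ φ) (u := u ∘ φ) hq (hpq.comp hφ.tendsto_atTop) (fun n => huA (φ n)) hc
    exact tendsto_nhds_unique (h1.congr fun n => val_quasiGreedy_one (hp1 _)) tendsto_const_nhds
  have hcexp : IsExpansionOf q 1 c := isExpansionOf_iff.2 ⟨hcA, hval.symm⟩
  have hinf : InfiniteSeq c := by
    by_contra hfin
    obtain ⟨K, hK⟩ := exists_tail_eq_zero hfin
    have h1 : conj A (tail (K + 1) c) = fun _ => A := by
      funext i
      simp [conj, tail, hK (K + 1 + i) (by omega)]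
    have h2 := hc2 (K + 1) (by omega)
    rw [h1] at h2
    rcases h2 with ⟨N, -, hN⟩ | h2
    · exact absurd (hcA N) (not_le.2 hN)
    · have := hK K le_rfl
      rw [← h2] at this
      exact hA0.ne' this
  have hcq : quasiGreedy q 1 = c := by
    refine quasiGreedy_eq_of_isQuasiGreedyOf (UpperLe.isQuasiGreedyOf hq hcexp hinf fun n _ => ?_)
    exact lexLe_trans (hc1 _) (lexLe_quasiGreedy_one hq hcA hinf hval.le)
  intro k hk
  rw [hcq]
  rcases hc2 k hk with h1 | h1
  · exact h1
  · obtain ⟨n, hn⟩ := (tendsto_nat_seq_iff.1 hc (2 * k)).exists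
    exact (false_of_conj_tail_eq hk hcA h1 hn (hu1 _) (hu2 _ k hk)).elim

end Univoque

/-! ### Approximation by univoque sequences -/

lemma exists_prefix_conj_lt {A : ℕ} {a : ℕ → ℕ} (h1 : ∀ k, LexLe (tail k a) a)
    (h2 : ∀ k, 1 ≤ k → LexLt (conj A (tail k a)) a) (n : ℕ) (hn : 2 ≤ n) :
    ∃ m, n ≤ m ∧ ∀ r, 1 ≤ r → r < m →
      ∃ t, r + t < m ∧ (∀ i < t, A - a (r + i) = a i) ∧ A - a (r + t) < a t := by
  choose! T hT hT' using h2
  simp only [conj, tail] at hT hT'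
  obtain ⟨s, hs, hmax⟩ := Finset.exists_max_image (Finset.Ico 1 n) (fun r => r + T r + 1)
    ⟨1, Finset.mem_Ico.2 ⟨le_rfl, hn⟩⟩
  rw [Finset.mem_Ico] at hs
  have hmax' : ∀ r, 1 ≤ r → r < n → r + T r + 1 ≤ s + T s + 1 := fun r hr hrn =>
    hmax r (Finset.mem_Ico.2 ⟨hr, hrn⟩)
  refine ⟨max n (s + T s + 1), le_max_left _ _, fun r hr hrm => ?_⟩
  rcases lt_or_ge r n with hrn | hrn
  · exact ⟨T r, by have := hmax' r hr hrn; omega, hT r hr, hT' r hr⟩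
  · obtain ⟨j, rfl⟩ := Nat.exists_eq_add_of_le (show s ≤ r by omega)
    have hjT : j ≤ T s := by omega
    obtain ⟨l, hl⟩ := Nat.exists_eq_add_of_le hjT
    have hlt : s + j + l < max n (s + T s + 1) := by omega
    have heq : ∀ i < l, A - a (s + j + i) = a (j + i) := fun i hi => by
      rw [Nat.add_assoc]
      exact hT s hs.1 (j + i) (by omega)
    have hend : A - a (s + j + l) < a (j + l) := by
      have := hT' s hs.1
      rwa [hl, ← Nat.add_assoc] at this
    rcases h1 j with ⟨t, ht, ht'⟩ | he
    · simp only [tail] at ht ht'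
      rcases lt_trichotomy t l with htl | rfl | htl
      · exact ⟨t, by omega, fun i hi => (heq i (hi.trans htl)).trans (ht i hi),
          (heq t htl).trans_lt ht'⟩
      · exact ⟨t, hlt, fun i hi => (heq i hi).trans (ht i hi), hend.trans ht'⟩
      · exact ⟨l, hlt, fun i hi => (heq i hi).trans (ht i (hi.trans htl)),
          hend.trans_eq (ht l htl)⟩
    · have he' : ∀ i, a (j + i) = a i := fun i => congrFun he i
      exact ⟨l, hlt, fun i hi => (heq i hi).trans (he' i), hend.trans_eq (he' l)⟩

/-- The periodic sequence whose period is the first `m` terms of `a` with the last one lowered. -/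
def lowered (a : ℕ → ℕ) (m : ℕ) : ℕ → ℕ := fun i =>
  if i % m = m - 1 then a (m - 1) - 1 else a (i % m)

section Lowered

variable {A m : ℕ} {a : ℕ → ℕ}

lemma lowered_of_lt {i : ℕ} (hi : i < m - 1) : lowered a m i = a i := by
  have h : i % m = i := Nat.mod_eq_of_lt (by omega)
  rw [lowered, h, if_neg hi.ne]

lemma lowered_last (hm : 0 < m) : lowered a m (m - 1) = a (m - 1) - 1 := by
  have h : (m - 1) % m = m - 1 := Nat.mod_eq_of_lt (by omega)
  rw [lowered, h, if_pos rfl]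

lemma lowered_add (k i : ℕ) : lowered a m (k + i) = lowered a m (k % m + i) := by
  simp only [lowered, Nat.mod_add_mod]

lemma lowered_add_period (i : ℕ) : lowered a m (m + i) = lowered a m i := by
  simp only [lowered, Nat.add_mod_left]

lemma lowered_le (ha : ∀ i, a i ≤ A) (i : ℕ) : lowered a m i ≤ A := by
  unfold lowered
  split_ifs
  · exact (Nat.sub_le _ _).trans (ha _)
  · exact ha _

lemma tail_lowered_lt (hm : 0 < m) (hpos : 0 < a (m - 1)) (h1 : ∀ k, LexLe (tail k a) a) (k : ℕ) :
    LexLt (tail k (lowered a m)) a := by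
  have hr := Nat.mod_lt k hm
  set r := k % m with hrdef
  have hg : ∀ i, r + i < m - 1 → tail k (lowered a m) i = a (r + i) := fun i hi => by
    rw [tail, lowered_add, ← hrdef, lowered_of_lt hi]
  have hg' : tail k (lowered a m) (m - 1 - r) = a (m - 1) - 1 := by
    rw [tail, lowered_add, ← hrdef, show r + (m - 1 - r) = m - 1 by omega, lowered_last hm]
  have hcase : (∃ t, r + t < m - 1 ∧ (∀ i < t, a (r + i) = a i) ∧ a (r + t) < a t) ∨
      ((∀ i, r + i < m - 1 → a (r + i) = a i) ∧ a (m - 1) ≤ a (m - 1 - r)) := by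
    rcases h1 r with ⟨t, ht, ht'⟩ | he
    · simp only [tail] at ht ht'
      by_cases htm : r + t < m - 1
      · exact Or.inl ⟨t, htm, ht, ht'⟩
      · refine Or.inr ⟨fun i hi => ht i (by omega), ?_⟩
        rcases (show m - 1 - r ≤ t by omega).lt_or_eq with h | h
        · have := ht _ h
          rw [show r + (m - 1 - r) = m - 1 by omega] at this
          exact this.le
        · rw [← h, show r + (m - 1 - r) = m - 1 by omega] at ht'
          exact ht'.le
    · have he' : ∀ i, a (r + i) = a i := fun i => congrFun he i
      refine Or.inr ⟨fun i _ => he' i, ?_⟩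
      have := he' (m - 1 - r)
      rw [show r + (m - 1 - r) = m - 1 by omega] at this
      exact this.le
  rcases hcase with ⟨t, htm, ht, ht'⟩ | ⟨h, h'⟩
  · exact ⟨t, fun i hi => (hg i (by omega)).trans (ht i hi), (hg t htm).trans_lt ht'⟩
  · exact ⟨m - 1 - r, fun i hi => (hg i (by omega)).trans (h i (by omega)), by omega⟩

lemma conj_tail_lowered_le (hm : 2 ≤ m) (hA : 0 < A) (ha : ∀ i, a i ≤ A) (ha0 : a 0 = A)
    (hpos : 0 < a (m - 1)) (h : ∀ r, 1 ≤ r → r < m →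
      ∃ t, r + t < m ∧ (∀ i < t, A - a (r + i) = a i) ∧ A - a (r + t) < a t) (k : ℕ) :
    LexLe (conj A (tail k (lowered a m))) (lowered a m) := by
  suffices key : ∀ N k, (∀ i < N, lowered a m i = A - lowered a m (k + i)) →
      ¬ lowered a m N < A - lowered a m (k + N) from
    lexLe_of_not_lexLt fun ⟨N, hN, hN'⟩ => key N k hN hN'
  intro N
  induction N using Nat.strong_induction_on with
  | _ N ih =>
  intro k hN hN'
  have hr := Nat.mod_lt k (show 0 < m by omega)
  simp only [lowered_add k] at hN hN'
  set r := k % m with hrdef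
  rcases Nat.eq_zero_or_pos r with hr0 | hr0
  · rw [hr0] at hN hN'
    have h0 : lowered a m 0 = A := by rw [lowered_of_lt (by omega), ha0]
    rcases Nat.eq_zero_or_pos N with rfl | hNpos
    · simp only [Nat.add_zero] at hN'
      omega
    · have := hN 0 hNpos
      simp only [Nat.add_zero] at this
      omega
  · obtain ⟨t, htm, ht, ht'⟩ := h r hr0 hr
    have hg : ∀ i < t, A - lowered a m (r + i) = lowered a m i := fun i hi => by
      rw [lowered_of_lt (show r + i < m - 1 by omega), lowered_of_lt (show i < m - 1 by omega)]
      exact ht i hi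
    have hgt : lowered a m t = a t := lowered_of_lt (by omega)
    rcases (show r + t ≤ m - 1 by omega).lt_or_eq with htl | htl
    · have hgt' : lowered a m (r + t) = a (r + t) := lowered_of_lt htl
      rcases lt_trichotomy N t with hNt | rfl | hNt
      · have := hg N hNt
        omega
      · omega
      · have := hN t hNt
        omega
    · have hgt' : lowered a m (r + t) = a (r + t) - 1 := by
        rw [htl, lowered_last (by omega)]
      have hpos' : 0 < a (r + t) := by rwa [htl]
      have hle := ha (r + t)
      rcases lt_trichotomy N t with hNt | rfl | hNt
      · have := hg N hNt
        omega
      · omega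
      · have hshift : ∀ i, lowered a m (r + (t + 1 + i)) = lowered a m i := fun i => by
          rw [show r + (t + 1 + i) = m + i by omega, lowered_add_period]
        refine ih (N - (t + 1)) (by omega) (t + 1) (fun i hi => ?_) ?_
        · have e1 := hN (t + 1 + i) (by omega)
          have e2 := lowered_le (m := m) ha i
          rw [hshift] at e1
          omega
        · have e1 := hshift (N - (t + 1))
          have e2 := lowered_le (m := m) ha (N - (t + 1))
          rw [show t + 1 + (N - (t + 1)) = N by omega] at e1 ⊢
          rw [e1] at hN'
          omega

end Lowered

section Approximation

variable {q : ℝ} {c : ℕ → ℕ}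

lemma exists_near_quasiGreedy_one (hq : 1 < q) (hS : ConjTailLt q) (N : ℕ) :
    ∃ g : ℕ → ℕ, (∀ i, g i ≤ alphaOne q) ∧ (∀ i < N, g i = quasiGreedy q 1 i) ∧
      (∀ k, LexLt (tail k g) (quasiGreedy q 1)) ∧
      ∀ k, LexLt (conj (alphaOne q) (tail k g)) (quasiGreedy q 1) := by
  have h1 := lexLe_tail_quasiGreedy_one hq
  have ha := quasiGreedy_one_le hq
  obtain ⟨m, hm, h⟩ := exists_prefix_conj_lt h1 hS (N + 2) (by omega)
  have hpos : 0 < quasiGreedy q 1 (m - 1) := by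
    obtain ⟨t, ht, -, ht'⟩ := h (m - 1) (by omega) (by omega)
    obtain rfl : t = 0 := by omega
    have := ha 0
    have h0 := quasiGreedy_one_zero hq
    rw [Nat.add_zero] at ht'
    omega
  have hlt := tail_lowered_lt (show 0 < m by omega) hpos h1
  refine ⟨lowered (quasiGreedy q 1) m, lowered_le ha, fun i hi => lowered_of_lt (by omega),
    hlt, fun k => lexLt_of_le_of_lt (conj_tail_lowered_le (by omega) (alphaOne_pos hq) ha
      (quasiGreedy_one_zero hq) hpos h k) ?_⟩
  have := hlt 0
  rwa [tail_zero] at this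

lemma exists_near_of_not_upperLt (hq : 1 < q) (hS : ConjTailLt q) (hc : ∀ i, c i ≤ alphaOne q)
    (hu : UpperLe q c) (hl : UpperLe q (conj (alphaOne q) c)) (hn : ¬ UpperLt q c) (N : ℕ) :
    ∃ d : ℕ → ℕ, (∀ i, d i ≤ alphaOne q) ∧ UpperLt q d ∧ UpperLt q (conj (alphaOne q) d) ∧
      ∀ i < N, d i = c i := by
  obtain ⟨n, hcn, hnlt⟩ : ∃ n, c n < alphaOne q ∧ ¬ LexLt (tail (n + 1) c) (quasiGreedy q 1) := by
    simpa [UpperLt] using hn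
  have htail : tail (n + 1) c = quasiGreedy q 1 := (hu n hcn).resolve_left hnlt
  have hstrict : ∀ j < n, conj (alphaOne q) c j < alphaOne q →
      LexLt (tail (j + 1) (conj (alphaOne q) c)) (quasiGreedy q 1) := by
    intro j hj hcj
    refine (hl j hcj).resolve_right fun he => ?_
    have h1 : conj (alphaOne q) (tail (n - j) (quasiGreedy q 1)) = quasiGreedy q 1 := by
      conv_lhs => rw [← he]
      rw [← htail]
      funext i
      have e1 : j + 1 + (n - j + i) = n + 1 + i := by omega
      simp only [conj, tail, e1]
      have := hc (n + 1 + i)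
      omega
    have h2 := hS (n - j) (by omega)
    rw [h1] at h2
    exact lexLt_irrefl _ h2
  choose! T hT hT' using hstrict
  set M := (Finset.range n).sup T with hM
  have hTM : ∀ j < n, T j ≤ M := fun j hj => Finset.le_sup (Finset.mem_range.2 hj)
  obtain ⟨g, hg, hga, hg1, hg2⟩ := exists_near_quasiGreedy_one hq hS (N + M + 1)
  have hd : ∀ i, splice (n + 1) c g (n + 1 + i) = g i := fun i => by
    rw [splice, if_neg (by omega), Nat.add_sub_cancel_left]
  have hdlt : ∀ i, i < n + 1 → splice (n + 1) c g i = c i := fun i hi => if_pos hi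
  have hagree : ∀ i, i < n + 1 + (N + M + 1) → splice (n + 1) c g i = c i := fun i hi => by
    rcases lt_or_ge i (n + 1) with h | h
    · exact hdlt i h
    · obtain ⟨i, rfl⟩ := Nat.exists_eq_add_of_le h
      rw [hd, hga i (by omega), ← htail, tail]
  have hdtail : ∀ j, n ≤ j → tail (j + 1) (splice (n + 1) c g) = tail (j - n) g := fun j hj => by
    funext i
    rw [tail, show j + 1 + i = n + 1 + (j - n + i) by omega, hd, tail]
  refine ⟨splice (n + 1) c g, fun i => ?_, fun j hj => ?_, fun j hj => ?_,
    fun i hi => hagree i (by omega)⟩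
  · unfold splice
    split_ifs
    · exact hc i
    · exact hg _
  · rcases lt_or_ge j n with h | h
    · rw [hdlt j (by omega)] at hj
      have hlt : LexLt (tail (j + 1) (splice (n + 1) c g)) (tail (j + 1) c) := by
        obtain ⟨t, ht, ht'⟩ := hg1 0
        rw [tail_zero, ← htail] at ht ht'
        refine ⟨n - j + t, fun i hi => ?_, ?_⟩
        · rcases lt_or_ge (j + 1 + i) (n + 1) with h' | h'
          · exact hdlt _ h'
          · obtain ⟨l, hl'⟩ := Nat.exists_eq_add_of_le h'
            rw [tail, tail, hl', hd]
            exact ht l (by omega)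
        · rw [tail, tail, show j + 1 + (n - j + t) = n + 1 + t by omega, hd]
          exact ht'
      rcases hu j hj with h' | h'
      · exact lexLt_trans hlt h'
      · rwa [h'] at hlt
    · rw [hdtail j h]
      exact hg1 _
  · rcases lt_or_ge j n with h | h
    · have hj' : conj (alphaOne q) c j < alphaOne q := by
        rwa [conj, hdlt j (by omega)] at hj
      have hTj := hTM j h
      have heq : ∀ i ≤ T j, tail (j + 1) (conj (alphaOne q) (splice (n + 1) c g)) i =
          tail (j + 1) (conj (alphaOne q) c) i := fun i hi => by
        rw [tail, conj, hagree _ (by omega), tail, conj]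
      exact ⟨T j, fun i hi => (heq i hi.le).trans (hT j h hj' i hi),
        (heq _ le_rfl).trans_lt (hT' j h hj')⟩
    · have := hg2 (j - n)
      rw [← hdtail j h] at this
      exact this

lemma exists_near (hq : 1 < q) (hS : ConjTailLt q) (hc : ∀ i, c i ≤ alphaOne q)
    (hu : UpperLe q c) (hl : UpperLe q (conj (alphaOne q) c)) (N : ℕ) :
    ∃ d : ℕ → ℕ, (∀ i, d i ≤ alphaOne q) ∧ UpperLt q d ∧ UpperLt q (conj (alphaOne q) d) ∧
      ∀ i < N, d i = c i := by
  by_cases h1 : UpperLt q c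
  · by_cases h2 : UpperLt q (conj (alphaOne q) c)
    · exact ⟨c, hc, h1, h2, fun _ _ => rfl⟩
    · obtain ⟨d, hd, hd1, hd2, hd3⟩ := exists_near_of_not_upperLt hq hS (conj_le _ c) hl
        (by rwa [conj_conj hc]) h2 N
      refine ⟨conj (alphaOne q) d, conj_le _ _, hd2, by rwa [conj_conj hd], fun i hi => ?_⟩
      have := hc i
      rw [conj, hd3 i hi, conj]
      omega
  · exact exists_near_of_not_upperLt hq hS hc hu hl h1 N

lemma val_mem_closure_Uq (hq : 1 < q) (hS : ConjTailLt q) (hc : ∀ i, c i ≤ alphaOne q)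
    (hu : UpperLe q c) (hl : UpperLe q (conj (alphaOne q) c)) : val q c ∈ closure (Uq q) := by
  choose d hd hd1 hd2 hd3 using exists_near hq hS hc hu hl
  have hlim : Tendsto d atTop (𝓝 c) := tendsto_nat_seq_iff.2 fun N => by
    filter_upwards [eventually_ge_atTop N] with n hn i hi
    exact hd3 n i (hi.trans_le hn)
  exact mem_closure_of_tendsto (tendsto_val hq tendsto_const_nhds hd hlim)
    (Eventually.of_forall fun n => val_mem_Uq hq (hd n) (hd1 n) (hd2 n))

end Approximation

/-! ### The closure of the univoque set -/

section Closure

variable {q x : ℝ}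

lemma upperLe_of_tendsto {u : ℕ → ℕ → ℕ} {c : ℕ → ℕ} (hc : Tendsto u atTop (𝓝 c))
    (hu : ∀ n, UpperLe q (u n)) : UpperLe q c := fun k hk => by
  refine lexLe_of_tendsto (tendsto_tail hc (k + 1)) tendsto_const_nhds ?_
  filter_upwards [tendsto_nat_seq_iff.1 hc (k + 1)] with n hn
  exact hu n k (by rwa [hn k k.lt_succ_self])

lemma mem_Vq_of_lexLe (hx : x ∈ Jq q) (h : ∀ n, 0 < quasiGreedy q x n →
    LexLe (conj (alphaOne q) (tail (n + 1) (quasiGreedy q x))) (quasiGreedy q 1)) : x ∈ Vq q :=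
  ⟨hx, h⟩

lemma closure_Uq_subset_Vq (hq : 1 < q) : closure (Uq q) ⊆ Vq q := by
  intro x hx
  obtain ⟨y, hy, hyx⟩ := mem_closure_iff_seq_limit.1 hx
  choose u hu using fun n => (hy n).exists
  obtain ⟨c, hcA, φ, hφ, hc⟩ := exists_subseq_tendsto fun n => (hu n).1
  have hup : UpperLe q c := upperLe_of_tendsto hc fun n =>
    (upperLt_of_unique hq (hy (φ n)) (hu (φ n))).upperLe
  have hlow : UpperLe q (conj (alphaOne q) c) := upperLe_of_tendsto (tendsto_conj hc _) fun n =>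
    (upperLt_of_unique hq (existsUnique_conj hq (hy (φ n)))
      (isExpansionOf_conj hq (hu (φ n)))).upperLe
  have hxc : IsExpansionOf q x c := by
    refine isExpansionOf_iff.2 ⟨hcA, ?_⟩
    have h1 := tendsto_val (p := fun _ => q) (u := u ∘ φ) hq tendsto_const_nhds
      (fun n => (hu (φ n)).1) hc
    exact tendsto_nhds_unique (hyx.comp hφ.tendsto_atTop)
      (h1.congr fun n => (isExpansionOf_iff.1 (hu (φ n))).2.symm)
  refine mem_Vq_of_lexLe (mem_Jq_of_isExpansionOf hq hxc) fun n hn => ?_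
  by_cases hinf : InfiniteSeq c
  · rw [quasiGreedy_eq_of_isQuasiGreedyOf (hup.isQuasiGreedyOf hq hxc hinf)] at hn ⊢
    refine hlow n ?_
    have := alphaOne_pos hq
    rw [conj]
    omega
  · obtain ⟨K, hK⟩ := exists_tail_eq_zero hinf
    by_cases hzero : ∀ i, c i = 0
    · have hx0 : x = 0 := by rw [(isExpansionOf_iff.1 hxc).2]; simp [val, hzero]
      rw [hx0, quasiGreedy_zero hq] at hn
      exact absurd hn (lt_irrefl _)
    · obtain ⟨i, hi⟩ := not_forall.1 hzero
      have hfin : {i | c i ≠ 0}.Finite := Set.not_infinite.1 hinf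
      obtain ⟨k, hk, hkmax⟩ := hfin.exists_maximalFor id _ ⟨i, hi⟩
      have h1 : tail (k + 1) (conj (alphaOne q) c) = fun _ => alphaOne q := by
        funext j
        have h2 : c (k + 1 + j) = 0 := by
          by_contra hne
          have : k + 1 + j ≤ k := hkmax hne (by simp only [id]; omega)
          omega
        simp [tail, conj, h2]
      have h3 := hlow k (by
        have := Nat.pos_of_ne_zero hk
        have := alphaOne_pos hq
        rw [conj]
        omega)
      rw [h1] at h3
      refine lexLe_trans (lexLe_of_not_lexLt ?_) h3
      rintro ⟨N, -, hN⟩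
      exact absurd hN (not_lt.2 (conj_le _ _ _))

lemma Vq_subset_closure_Uq (hq : 1 < q) (hS : ConjTailLt q) : Vq q ⊆ closure (Uq q) := by
  intro x hx
  rcases hx.1.1.eq_or_lt with rfl | hpos
  · have h1 : val q (fun _ => 0) = 0 := by simp [val]
    rw [← h1]
    refine val_mem_closure_Uq hq hS (fun _ => Nat.zero_le _) (fun n _ => Or.inl ?_) fun n hn => ?_
    · refine ⟨0, fun i hi => absurd hi (Nat.not_lt_zero _), ?_⟩
      rw [quasiGreedy_one_zero hq]
      exact alphaOne_pos hq
    · exact absurd hn (lt_irrefl _)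
  · have h1 := (quasiGreedy_spec hq hpos hx.1.2).1
    rw [(isExpansionOf_iff.1 h1).2]
    refine val_mem_closure_Uq hq hS h1.1 (upperLe_quasiGreedy hq hpos hx.1.2) fun n hn => ?_
    refine hx.2 n (Nat.pos_of_ne_zero fun h0 => ?_)
    rw [conj, h0] at hn
    exact absurd hn (lt_irrefl _)

end Closure

end UnivoqueExpansion

/-- If `q > 1` lies in the closure of `U`, then the closure of `U_q`
equals `V_q`. -/
theorem closure_Uq_eq_Vq (q : ℝ) (hq : 1 < q) (h : q ∈ closure USet) :
    closure (Uq q) = Vq q := by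
  exact (UnivoqueExpansion.closure_Uq_subset_Vq hq).antisymm
    (UnivoqueExpansion.Vq_subset_closure_Uq hq (UnivoqueExpansion.conjTailLt_of_mem_closure hq h))
end
end
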